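/- Let ε > 0. Then for every odd integer s ≥ 3 that is sufficiently large with respect to ε, the dimension of the ℚ-vector space spanned by the real numbers 1, ζ(3), ζ(5), ζ(7), …, ζ(s) is at least ((1-ε)/(1+log 2))·log s. Formally: for every ε > 0 there exists S such that for all odd s ≥ S, Module.finrank ℚ of the ℚ-span of {1} ∪ {ζ(i) : i odd, 3 ≤ i ≤ s} inside ℝ is ≥ ((1-ε)/(1+log 2))·log s. -/

import Mathlib

/-- The Riemann zeta value `ζ(i) = ∑_{m ≥ 1} 1/m^i`, as a real number. -/
noncomputable def zetaVal (i : ℕ) : ℝ := ∑' m : ℕ, 1 / ((m : ℝ) + 1) ^ i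

/-- Dirichlet's theorem on simultaneous approximation. -/
theorem exists_simultaneous_approx {m : ℕ} (x : Fin m → ℝ) {N : ℕ} (hN : 0 < N) :
    ∃ q : ℕ, 0 < q ∧ q ≤ N ^ m ∧ ∃ p : Fin m → ℤ, ∀ i, |(p i : ℝ) - q * x i| ≤ 1 / N := by
  have hNR : (0 : ℝ) < N := by exact_mod_cast hN
  let f : Fin (N ^ m + 1) → (Fin m → Fin N) := fun q i =>
    ⟨⌊Int.fract ((q : ℕ) * x i) * N⌋₊, by
      rw [Nat.floor_lt (by positivity)]
      nlinarith [Int.fract_lt_one ((q : ℕ) * x i)]⟩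
  obtain ⟨q₁, q₂, hne, hf⟩ : ∃ q₁ q₂, q₁ ≠ q₂ ∧ f q₁ = f q₂ :=
    Fintype.exists_ne_map_eq_of_card_lt f (by simp)
  wlog hlt : q₁ < q₂ generalizing q₁ q₂
  · exact this q₂ q₁ hne.symm hf.symm (lt_of_le_of_ne (not_lt.mp hlt) hne.symm)
  have hlt' : (q₁ : ℕ) < q₂ := hlt
  refine ⟨q₂ - q₁, by omega, by omega, fun i => ⌊(q₂ : ℕ) * x i⌋ - ⌊(q₁ : ℕ) * x i⌋, fun i => ?_⟩
  have h : ⌊Int.fract ((q₁ : ℕ) * x i) * N⌋₊ = ⌊Int.fract ((q₂ : ℕ) * x i) * N⌋₊ :=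
    congrArg Fin.val (congrFun hf i)
  have h1 := Nat.floor_le (a := Int.fract ((q₁ : ℕ) * x i) * N) (by positivity)
  have h2 := Nat.lt_floor_add_one (Int.fract ((q₁ : ℕ) * x i) * N)
  have h3 := Nat.floor_le (a := Int.fract ((q₂ : ℕ) * x i) * N) (by positivity)
  have h4 := Nat.lt_floor_add_one (Int.fract ((q₂ : ℕ) * x i) * N)
  rw [h] at h1 h2
  have e1 := Int.self_sub_floor ((q₁ : ℕ) * x i)
  have e2 := Int.self_sub_floor ((q₂ : ℕ) * x i)
  have key : |((⌊(q₂ : ℕ) * x i⌋ - ⌊(q₁ : ℕ) * x i⌋ : ℝ) - ((q₂ : ℕ) - (q₁ : ℕ)) * x i) * N| ≤ 1 := by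
    rw [abs_le]
    constructor <;> nlinarith
  rw [abs_mul, abs_of_pos hNR] at key
  rw [Nat.cast_sub hlt'.le, le_div_iff₀ hNR]
  push_cast
  exact key

open Filter in
/-- Nesterenko's linear independence criterion, in coordinates. -/
theorem decay_le_of_forms_fin {m : ℕ} (x : Fin m → ℝ) (P : ℕ → ℤ) (l : ℕ → Fin m → ℤ)
    {a b C : ℝ} (hb : 0 ≤ b)
    (hl : ∀ᶠ n in atTop, ∀ i, |(l n i : ℝ)| ≤ C * Real.exp (b * n))
    (hpos : ∀ n, 0 < P n + ∑ i, l n i * x i)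
    (hup : ∀ᶠ n : ℕ in atTop, P n + ∑ i, l n i * x i ≤ C * Real.exp (-a * n))
    (hratio : ∀ η > 0, ∀ᶠ n : ℕ in atTop, (P n + ∑ i, l n i * x i) * Real.exp (-η * n) ≤
      P (n + 1) + ∑ i, l (n + 1) i * x i) :
    a ≤ b * m := by
  by_contra! hlt
  set L : ℕ → ℝ := fun n => P n + ∑ i, l n i * x i with hL
  have hCpos : 0 < C := by
    obtain ⟨n, hn⟩ := hup.exists
    have := (hpos n).trans_le hn
    exact pos_of_mul_pos_left this (Real.exp_pos _).le
  have ha : 0 < a := lt_of_le_of_lt (by positivity) hlt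
  obtain ⟨η, hη, hηlt⟩ : ∃ η > 0, (b + η) * m < a := by
    refine ⟨(a - b * m) / (2 * (m + 1)), by apply div_pos <;> [linarith; positivity], ?_⟩
    have : (a - b * m) / (2 * (m + 1)) * m ≤ (a - b * m) / 2 := by
      rw [div_mul_eq_mul_div, div_le_div_iff₀ (by positivity) (by positivity)]
      nlinarith
    nlinarith
  have hexp : ∀ c > 0, Tendsto (fun n : ℕ => Real.exp (-c * n)) atTop (nhds 0) := by
    intro c hc
    apply Real.tendsto_exp_atBot.comp
    exact (tendsto_natCast_atTop_atTop).const_mul_atTop_of_neg (by linarith)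
  have hsmall : ∀ᶠ n : ℕ in atTop,
      2 * C * Real.exp a * (2 * C * m * Real.exp (b + η)) ^ m *
        Real.exp (-(a - (b + η) * m) * n) < 1 := by
    have := (hexp (a - (b + η) * m) (by linarith)).const_mul
      (2 * C * Real.exp a * (2 * C * m * Real.exp (b + η)) ^ m)
    rw [mul_zero] at this
    exact this.eventually_lt_const one_pos
  obtain ⟨n₀, hn₀⟩ := eventually_atTop.mp (hl.and (hup.and ((hratio η hη).and hsmall)))
  have hn0 := hpos n₀
  -- choose the quality of approximation
  obtain ⟨N, hN⟩ := exists_nat_gt (m * (C * Real.exp (b * n₀)) / L n₀ + 1)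
  have hNpos : 0 < N := by
    have : (0 : ℝ) < N := lt_trans (by positivity) hN
    exact_mod_cast this
  have hNR : (0 : ℝ) < N := by exact_mod_cast hNpos
  obtain ⟨q, hq, hqN, p, hp⟩ := exists_simultaneous_approx x hNpos
  have hqR : (1 : ℝ) ≤ q := by exact_mod_cast hq
  have hex : ∃ n, n₀ ≤ n ∧ q * L n < 1 / 2 := by
    have h1 : ∀ᶠ n : ℕ in atTop, q * C * Real.exp (-a * n) < 1 / 2 := by
      have := (hexp a ha).const_mul (q * C)
      rw [mul_zero] at this
      exact this.eventually_lt_const (by norm_num)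
    obtain ⟨n, hn1, hn2⟩ := (h1.and (eventually_ge_atTop n₀)).exists
    refine ⟨n, hn2, lt_of_le_of_lt ?_ hn1⟩
    rw [mul_assoc]
    exact mul_le_mul_of_nonneg_left (hn₀ n hn2).2.1 (by positivity)
  classical
  let n := Nat.find hex
  obtain ⟨hn, hqn⟩ : n₀ ≤ n ∧ q * L n < 1 / 2 := Nat.find_spec hex
  have herr : |∑ i, (l n i : ℝ) * (p i - q * x i)| ≤ m * (C * Real.exp (b * n)) / N := by
    calc |∑ i, (l n i : ℝ) * (p i - q * x i)| ≤ ∑ i, |(l n i : ℝ) * (p i - q * x i)| :=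
          Finset.abs_sum_le_sum_abs _ _
      _ ≤ ∑ _i : Fin m, (C * Real.exp (b * n)) * (1 / N) := by
          refine Finset.sum_le_sum fun i _ => ?_
          rw [abs_mul]
          exact mul_le_mul ((hn₀ n hn).1 i) (hp i) (abs_nonneg _) (by positivity)
      _ = _ := by simp; ring
  have hlt : m * (C * Real.exp (b * n)) / N < q * L n := by
    rcases hn.eq_or_lt with heq | hgt
    · rw [← heq, div_lt_iff₀ hNR]
      have : m * (C * Real.exp (b * n₀)) / L n₀ < N := by linarith
      rw [div_lt_iff₀ hn0] at this
      have h3 : N * L n₀ ≤ q * (N * L n₀) := le_mul_of_one_le_left (by positivity) hqR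
      linarith
    · by_contra! hcon
      have hmin := Nat.find_min hex (m := n - 1) (by omega)
      obtain ⟨k, hk⟩ : ∃ k, n = k + 1 := ⟨n - 1, by omega⟩
      simp only [hk, Nat.add_sub_cancel] at hmin
      have hk0 : n₀ ≤ k := by omega
      have hkL : 1 / 2 ≤ q * L k := by
        by_contra! h
        exact hmin ⟨hk0, h⟩
      obtain ⟨-, hk1, hk2, hk3⟩ := hn₀ k hk0
      have hqL : 1 / 2 * Real.exp (-η * k) ≤ q * L n := by
        rw [hk]
        calc 1 / 2 * Real.exp (-η * k) ≤ q * L k * Real.exp (-η * k) := by gcongr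
          _ = q * (L k * Real.exp (-η * k)) := by ring
          _ ≤ _ := mul_le_mul_of_nonneg_left hk2 (by positivity)
      have hqlow : 1 / 2 ≤ q * (C * Real.exp (-a * k)) :=
        hkL.trans (mul_le_mul_of_nonneg_left hk1 (by positivity))
      have hqN' : (q : ℝ) ≤ N ^ m := by exact_mod_cast hqN
      have hNup : (N : ℝ) ≤ 2 * C * m * Real.exp (b + η) * Real.exp ((b + η) * k) := by
        have h1 := hqL.trans hcon
        rw [le_div_iff₀ hNR] at h1
        have h2 : Real.exp (b * n) = Real.exp (b * k) * Real.exp b := by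
          rw [← Real.exp_add, hk]; push_cast; ring_nf
        have h3 : (N : ℝ) = 2 * (1 / 2 * Real.exp (-η * k) * N) * Real.exp (η * k) := by
          have : Real.exp (-η * k) * Real.exp (η * k) = 1 := by
            rw [← Real.exp_add]; simp
          linear_combination (-N : ℝ) * this
        rw [h3]
        calc _ ≤ 2 * (m * (C * Real.exp (b * n))) * Real.exp (η * k) := by gcongr
          _ = 2 * C * m * Real.exp b * Real.exp ((b + η) * k) := by
            rw [h2, add_mul, Real.exp_add]; ring
          _ ≤ _ := by gcongr; linarith
      have h4 : 1 / 2 ≤ (2 * C * m * Real.exp (b + η) * Real.exp ((b + η) * k)) ^ m *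
          (C * Real.exp (-a * k)) := by
        refine hqlow.trans (mul_le_mul_of_nonneg_right (hqN'.trans ?_) (by positivity))
        gcongr
      have h5 : (2 * C * m * Real.exp (b + η) * Real.exp ((b + η) * k)) ^ m *
          (C * Real.exp (-a * k)) = C * (2 * C * m * Real.exp (b + η)) ^ m *
            Real.exp (-(a - (b + η) * m) * k) := by
        rw [mul_pow (2 * C * m * Real.exp (b + η)), ← Real.exp_nat_mul,
          show -(a - (b + η) * m) * k = m * ((b + η) * k) + -a * k by ring,
          Real.exp_add (m * ((b + η) * k)) (-a * k)]
        ring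
      rw [h5] at h4
      have h6 : (1 : ℝ) ≤ Real.exp a := Real.one_le_exp ha.le
      have h7 : 0 ≤ C * (2 * C * m * Real.exp (b + η)) ^ m *
            Real.exp (-(a - (b + η) * m) * k) := by positivity
      nlinarith
  -- the linear form at the approximating integer vector is an integer in `(-1, 1) \ {0}`
  have hZ : ((q * P n + ∑ i, l n i * p i : ℤ) : ℝ) =
      q * L n + ∑ i, (l n i : ℝ) * (p i - q * x i) := by
    push_cast
    simp only [hL, mul_add, Finset.mul_sum, mul_sub, Finset.sum_sub_distrib]
    have : ∑ i, (l n i : ℝ) * (q * x i) = ∑ i, q * (l n i * x i) :=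
      Finset.sum_congr rfl fun i _ => by ring
    rw [this]; ring
  have hb1 := abs_le.mp (herr.trans hlt.le)
  have hb2 := abs_lt.mp (herr.trans_lt hlt)
  have h8 : (0 : ℝ) < ((q * P n + ∑ i, l n i * p i : ℤ) : ℝ) := by rw [hZ]; linarith
  have h9 : ((q * P n + ∑ i, l n i * p i : ℤ) : ℝ) < 1 := by rw [hZ]; linarith
  have h10 : 0 < (q * P n + ∑ i, l n i * p i : ℤ) := by exact_mod_cast h8
  have h11 : (q * P n + ∑ i, l n i * p i : ℤ) < 1 := by exact_mod_cast h9
  omega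

open Filter in
/-- Nesterenko's linear independence criterion. -/
theorem decay_le_of_forms {ι : Type*} [Fintype ι] (V : Submodule ℚ ℝ) [FiniteDimensional ℚ V]
    (ξ : ι → ℝ) (hξ : ∀ i, ξ i ∈ V) (l : ℕ → ι → ℤ) {a b C : ℝ} (hb : 0 ≤ b)
    (hl : ∀ᶠ n in atTop, ∀ i, |(l n i : ℝ)| ≤ C * Real.exp (b * n))
    (hpos : ∀ n, 0 < ∑ i, l n i * ξ i)
    (hup : ∀ᶠ n : ℕ in atTop, ∑ i, l n i * ξ i ≤ C * Real.exp (-a * n))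
    (hratio : ∀ η > 0, ∀ᶠ n : ℕ in atTop, (∑ i, l n i * ξ i) * Real.exp (-η * n) ≤
      ∑ i, l (n + 1) i * ξ i) :
    a ≤ b * (Module.finrank ℚ V - 1) := by
  obtain ⟨d, hd⟩ : ∃ d, Module.finrank ℚ V = d := ⟨_, rfl⟩
  have B := Module.finBasisOfFinrankEq ℚ V hd
  have hCpos : 0 < C := by
    obtain ⟨n, hn⟩ := hup.exists
    exact pos_of_mul_pos_left ((hpos n).trans_le hn) (Real.exp_pos _).le
  have hexpand : ∀ j, ξ j = ∑ i, (B.repr ⟨ξ j, hξ j⟩ i : ℝ) * (B i : ℝ) := by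
    intro j
    have h := congrArg (Subtype.val) (B.sum_repr ⟨ξ j, hξ j⟩)
    simp only [AddSubmonoidClass.coe_finsetSum, Submodule.coe_smul, Rat.smul_def] at h
    exact h.symm
  rcases d with _ | d
  · exfalso
    have h0 : ∀ j, ξ j = 0 := fun j => (hexpand j).trans (by simp)
    have h1 := hpos 0
    simp [h0] at h1
  set D : ℕ := ∏ j, ∏ i, (B.repr ⟨ξ j, hξ j⟩ i).den with hD
  have hDpos : 0 < D := Finset.prod_pos fun j _ => Finset.prod_pos fun i _ => Rat.den_pos _
  have hDR : (0 : ℝ) < D := by exact_mod_cast hDpos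
  have h_int : ∀ j i, ∃ z : ℤ, (D : ℝ) * (B.repr ⟨ξ j, hξ j⟩ i : ℝ) = z := by
    intro j i
    have hdvd : (B.repr ⟨ξ j, hξ j⟩ i).den ∣ D :=
      (Finset.dvd_prod_of_mem _ (Finset.mem_univ i)).trans
        (Finset.dvd_prod_of_mem (fun j => ∏ i, (B.repr ⟨ξ j, hξ j⟩ i).den) (Finset.mem_univ j))
    obtain ⟨k, hk⟩ := hdvd
    refine ⟨k * (B.repr ⟨ξ j, hξ j⟩ i).num, ?_⟩
    have h := Rat.den_mul_eq_num (B.repr ⟨ξ j, hξ j⟩ i)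
    have h' : (((B.repr ⟨ξ j, hξ j⟩ i).den : ℚ) : ℝ) * (B.repr ⟨ξ j, hξ j⟩ i : ℝ) =
        (((B.repr ⟨ξ j, hξ j⟩ i).num : ℚ) : ℝ) := by
      exact_mod_cast h
    rw [hk]
    push_cast at h' ⊢
    linear_combination (k : ℝ) * h'
  choose c hc using h_int
  have hv0 : (B 0 : ℝ) ≠ 0 := by
    have := B.ne_zero 0
    simpa using this
  have habs : 0 < |(B 0 : ℝ)| := abs_pos.mpr hv0
  obtain ⟨σ, hσ⟩ : ∃ σ : ℤ, (B 0 : ℝ) / |(B 0 : ℝ)| = σ := by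
    rcases lt_or_gt_of_ne hv0 with h | h
    · exact ⟨-1, by rw [abs_of_neg h, div_neg, div_self hv0]; simp⟩
    · exact ⟨1, by rw [abs_of_pos h, div_self hv0]; simp⟩
  have hform : ∀ n, ((σ * ∑ j, l n j * c j 0 : ℤ) : ℝ) +
      ∑ i : Fin d, ((∑ j, l n j * c j i.succ : ℤ) : ℝ) * ((B i.succ : ℝ) / |(B 0 : ℝ)|) =
      D / |(B 0 : ℝ)| * ∑ j, l n j * ξ j := by
    intro n
    have h1 : (D : ℝ) * ∑ j, l n j * ξ j =
        ∑ i, ((∑ j, l n j * c j i : ℤ) : ℝ) * (B i : ℝ) := by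
      push_cast
      simp_rw [← hc, Finset.sum_mul]
      rw [Finset.sum_comm, Finset.mul_sum]
      refine Finset.sum_congr rfl fun j _ => ?_
      conv_lhs => rw [hexpand j]
      simp_rw [Finset.mul_sum]
      exact Finset.sum_congr rfl fun i _ => by ring
    rw [div_mul_eq_mul_div, h1, Fin.sum_univ_succ, add_div, Finset.sum_div]
    congr 1
    · rw [Int.cast_mul, ← hσ]; ring
    · exact Finset.sum_congr rfl fun i _ => by ring
  set K : ℝ := D / |(B 0 : ℝ)| with hK
  have hKpos : 0 < K := by positivity
  set M : ℝ := ∑ j, ∑ i, |(c j i : ℝ)| with hM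
  have hMnn : 0 ≤ M := Finset.sum_nonneg fun j _ => Finset.sum_nonneg fun i _ => abs_nonneg _
  have key := decay_le_of_forms_fin (fun i : Fin d => (B i.succ : ℝ) / |(B 0 : ℝ)|)
    (fun n => σ * ∑ j, l n j * c j 0) (fun n i => ∑ j, l n j * c j i.succ)
    (a := a) (b := b) (C := C * (M + K)) hb ?_ ?_ ?_ ?_
  · rw [hd]; push_cast; linarith
  · filter_upwards [hl] with n hn i
    push_cast
    calc |∑ j, (l n j : ℝ) * c j i.succ| ≤ ∑ j, |(l n j : ℝ) * c j i.succ| :=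
          Finset.abs_sum_le_sum_abs _ _
      _ ≤ ∑ j, (C * Real.exp (b * n)) * ∑ i, |(c j i : ℝ)| := by
          refine Finset.sum_le_sum fun j _ => ?_
          rw [abs_mul]
          refine mul_le_mul (hn j) ?_ (abs_nonneg _) (by positivity)
          exact Finset.single_le_sum (f := fun i => |(c j i : ℝ)|)
            (fun _ _ => abs_nonneg _) (Finset.mem_univ _)
      _ = C * M * Real.exp (b * n) := by rw [← Finset.mul_sum, ← hM]; ring
      _ ≤ _ := by gcongr; linarith
  · intro n
    rw [hform]
    exact mul_pos hKpos (hpos n)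
  · filter_upwards [hup] with n hn
    rw [hform]
    calc K * ∑ i, l n i * ξ i ≤ K * (C * Real.exp (-a * n)) := by gcongr
      _ = C * K * Real.exp (-a * n) := by ring
      _ ≤ _ := by gcongr; linarith
  · intro η hη
    filter_upwards [hratio η hη] with n hn
    rw [hform, hform, mul_assoc]
    gcongr

open MeasureTheory Filter Topology Set in
/-- The Fejér kernel is integrable. -/
theorem integrable_sinc_sq : Integrable fun v : ℝ => Real.sinc v ^ 2 := by
  refine (integrable_inv_one_add_sq.const_mul 2).mono'
    (Real.continuous_sinc.pow 2).aestronglyMeasurable (ae_of_all _ fun v => ?_)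
  rw [Real.norm_of_nonneg (sq_nonneg _), ← div_eq_mul_inv, le_div_iff₀ (by positivity)]
  have h1 : Real.sinc v ^ 2 ≤ 1 := by
    rw [← sq_abs]; exact pow_le_one₀ (abs_nonneg _) (Real.abs_sinc_le_one v)
  have h2 : Real.sinc v ^ 2 * v ^ 2 ≤ 1 := by
    rcases eq_or_ne v 0 with rfl | hv
    · simp
    · rw [Real.sinc_of_ne_zero hv, div_pow, div_mul_cancel₀ _ (by positivity)]
      exact Real.sin_sq_le_one v
  linarith

/-- The Fejér kernel as a cosine transform. -/
theorem integral_fejer_eq_sinc_sq (v : ℝ) :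
    ∫ τ in (0 : ℝ)..2, (1 - τ / 2) * Real.cos (τ * v) = Real.sinc v ^ 2 := by
  rcases eq_or_ne v 0 with rfl | hv
  · simp only [mul_zero, Real.cos_zero, mul_one, Real.sinc_zero]
    rw [intervalIntegral.integral_sub (by simp) (by simp), intervalIntegral.integral_div,
      integral_id]
    norm_num
  · have hderiv : ∀ τ ∈ Set.uIcc (0 : ℝ) 2, HasDerivAt
        (fun τ => (1 - τ / 2) * Real.sin (τ * v) / v - Real.cos (τ * v) / (2 * v ^ 2))
        ((1 - τ / 2) * Real.cos (τ * v)) τ := by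
      intro τ _
      have h1 : HasDerivAt (fun τ : ℝ => 1 - τ / 2) (-(1 / 2)) τ :=
        ((hasDerivAt_id τ).div_const 2).const_sub 1
      have h2 : HasDerivAt (fun τ : ℝ => τ * v) v τ := by
        simpa using (hasDerivAt_id τ).mul_const v
      have h3 := ((h1.mul h2.sin).div_const v).sub (h2.cos.div_const (2 * v ^ 2))
      refine h3.congr_deriv ?_
      field_simp
      ring
    rw [intervalIntegral.integral_eq_sub_of_hasDerivAt hderiv
      (Continuous.intervalIntegrable (by fun_prop) _ _), Real.sinc_of_ne_zero hv]
    have : Real.cos (2 * v) = 1 - 2 * Real.sin v ^ 2 := by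
      rw [Real.cos_two_mul]; linarith [Real.sin_sq_add_cos_sq v]
    simp only [this]
    field_simp
    simp
    try ring

open MeasureTheory Filter Topology Set in
/-- Smoothing the boundary values of a Laplace transform by the Fejér kernel. -/
theorem integral_fejer_boundary (f : ℝ → ℝ) (hf : Measurable f) {C : ℝ} (hC : ∀ u, |f u| ≤ C)
    (G : ℂ → ℂ) (hG : ContinuousOn G {s | 0 ≤ s.re})
    (hGf : ∀ s : ℂ, 0 < s.re → G s = ∫ u in Ioi (0 : ℝ), (f u : ℂ) * Complex.exp (-s * u))
    {lam : ℝ} (hlam : 0 < lam) (y : ℝ) :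
    ∫ τ in (0 : ℝ)..2, (1 - τ / 2) *
      (Complex.exp (Complex.I * (τ * y : ℝ)) * G (Complex.I * (lam * τ : ℝ))).re =
    ∫ u in Ioi (0 : ℝ), f u * Real.sinc (y - lam * u) ^ 2 := by
  have hC0 : 0 ≤ C := (abs_nonneg _).trans (hC 0)
  set G' : ℂ → ℂ := fun s => G ((max s.re 0 : ℝ) + Complex.I * s.im) with hG'
  have hG'c : Continuous G' := by
    refine hG.comp_continuous (by fun_prop) fun s => ?_
    simp
  have hG'eq : ∀ σ : ℝ, 0 ≤ σ → ∀ t : ℝ, G' (σ + Complex.I * t) = G (σ + Complex.I * t) := by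
    intro σ hσ t
    simp [hG', hσ]
  have hexpint : ∀ σ : ℝ, 0 < σ →
      Integrable (fun u : ℝ => C * Real.exp (-σ * u)) (volume.restrict (Ioi 0)) := fun σ hσ =>
    ((exp_neg_integrableOn_Ioi 0 hσ).integrable).const_mul C
  have hpos : ∀ σ : ℝ, 0 < σ →
      ∫ τ in (0 : ℝ)..2, (1 - τ / 2) *
        (Complex.exp (Complex.I * (τ * y : ℝ)) * G' (σ + Complex.I * (lam * τ : ℝ))).re =
      ∫ u in Ioi (0 : ℝ), f u * Real.exp (-σ * u) * Real.sinc (y - lam * u) ^ 2 := by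
    intro σ hσ
    have h1 : ∀ τ : ℝ, (Complex.exp (Complex.I * (τ * y : ℝ)) *
        G' (σ + Complex.I * (lam * τ : ℝ))).re =
        ∫ u in Ioi (0 : ℝ), f u * Real.exp (-σ * u) * Real.cos (τ * (y - lam * u)) := by
      intro τ
      rw [hG'eq σ hσ.le, hGf _ (by simpa using hσ), ← integral_const_mul]
      have h_int : Integrable (fun u : ℝ => Complex.exp (Complex.I * (τ * y : ℝ)) * ((f u : ℂ) *
          Complex.exp (-(σ + Complex.I * (lam * τ : ℝ)) * u))) (volume.restrict (Ioi 0)) := by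
        refine (hexpint σ hσ).mono' (by fun_prop) (ae_of_all _ fun u => ?_)
        simp only [norm_mul, Complex.norm_exp, Complex.norm_real, Real.norm_eq_abs]
        simp
        exact mul_le_mul_of_nonneg_right (hC u) (Real.exp_pos _).le
      rw [← RCLike.re_eq_complex_re, ← integral_re h_int]
      refine integral_congr_ae (ae_of_all _ fun u => ?_)
      simp only [RCLike.re_eq_complex_re]
      have : Complex.exp (Complex.I * (τ * y : ℝ)) * ((f u : ℂ) *
          Complex.exp (-(σ + Complex.I * (lam * τ : ℝ)) * u)) =
          ((f u * Real.exp (-σ * u) : ℝ) : ℂ) *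
            Complex.exp ((τ * (y - lam * u) : ℝ) * Complex.I) := by
        push_cast
        rw [mul_left_comm, mul_assoc, ← Complex.exp_add, ← Complex.exp_add]
        congr 2
        ring
      rw [this, Complex.re_ofReal_mul, Complex.exp_ofReal_mul_I_re]
    simp_rw [h1, ← integral_const_mul]
    rw [intervalIntegral_integral_swap]
    · refine integral_congr_ae (ae_of_all _ fun u => ?_)
      simp only
      rw [← integral_fejer_eq_sinc_sq, ← intervalIntegral.integral_const_mul]
      refine intervalIntegral.integral_congr fun τ _ => ?_
      ring
    · have : IsFiniteMeasure (volume.restrict (uIoc (0 : ℝ) 2)) := by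
        rw [uIoc_of_le (by norm_num)]; infer_instance
      have hd : Integrable (fun z : ℝ × ℝ => (1 : ℝ) * (C * Real.exp (-σ * z.2)))
          ((volume.restrict (uIoc (0 : ℝ) 2)).prod (volume.restrict (Ioi 0))) :=
        Integrable.mul_prod (f := fun _ : ℝ => (1 : ℝ)) (integrable_const _) (hexpint σ hσ)
      refine hd.mono' ?_ ?_
      · refine Measurable.aestronglyMeasurable ?_
        unfold Function.uncurry
        fun_prop
      · rw [Measure.prod_restrict, ae_restrict_iff' (by measurability)]
        refine ae_of_all _ fun z hz => ?_
        have hz1 : z.1 ∈ Ioc (0 : ℝ) 2 := by simpa using hz.1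
        have ha : |1 - z.1 / 2| ≤ 1 := by rw [abs_le]; constructor <;> linarith [hz1.1, hz1.2]
        simp only [Function.uncurry, norm_mul, Real.norm_eq_abs, Real.abs_exp]
        refine mul_le_mul ha ?_ (by positivity) zero_le_one
        calc |f z.2| * Real.exp (-σ * z.2) * |Real.cos (z.1 * (y - lam * z.2))|
            ≤ C * Real.exp (-σ * z.2) * 1 := by
              gcongr
              · exact hC _
              · exact Real.abs_cos_le_one _
          _ = _ := mul_one _
  have hL : Tendsto (fun σ : ℝ => ∫ τ in (0 : ℝ)..2, (1 - τ / 2) *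
        (Complex.exp (Complex.I * (τ * y : ℝ)) * G' (σ + Complex.I * (lam * τ : ℝ))).re)
      (𝓝[>] 0) (𝓝 (∫ τ in (0 : ℝ)..2, (1 - τ / 2) *
      (Complex.exp (Complex.I * (τ * y : ℝ)) * G (Complex.I * (lam * τ : ℝ))).re)) := by
    have hc : Continuous (fun σ : ℝ => ∫ τ in (0 : ℝ)..2, (1 - τ / 2) *
        (Complex.exp (Complex.I * (τ * y : ℝ)) * G' (σ + Complex.I * (lam * τ : ℝ))).re) := by
      apply intervalIntegral.continuous_parametric_intervalIntegral_of_continuous'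
      unfold Function.uncurry
      fun_prop
    have := hc.tendsto 0
    simp_rw [hG'eq 0 le_rfl, Complex.ofReal_zero, zero_add] at this
    exact this.mono_left nhdsWithin_le_nhds
  have hsinc : Integrable (fun u : ℝ => Real.sinc (y - lam * u) ^ 2) :=
    ((integrable_sinc_sq.comp_sub_left y).comp_mul_left' hlam.ne')
  have hR : Tendsto (fun σ : ℝ => ∫ u in Ioi (0 : ℝ),
        f u * Real.exp (-σ * u) * Real.sinc (y - lam * u) ^ 2)
      (𝓝[>] 0) (𝓝 (∫ u in Ioi (0 : ℝ), f u * Real.sinc (y - lam * u) ^ 2)) := by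
    have hsm : Measurable Real.sinc := Real.continuous_sinc.measurable
    refine tendsto_integral_filter_of_dominated_convergence
      (fun u => C * Real.sinc (y - lam * u) ^ 2) ?_ ?_ (hsinc.integrableOn.const_mul C) ?_
    · exact Eventually.of_forall fun σ => by fun_prop
    · filter_upwards [self_mem_nhdsWithin] with σ hσ
      refine (ae_restrict_iff' measurableSet_Ioi).mpr (ae_of_all _ fun u hu => ?_)
      rw [norm_mul, norm_mul, Real.norm_of_nonneg (sq_nonneg (Real.sinc _)),
        Real.norm_of_nonneg (Real.exp_pos _).le, Real.norm_eq_abs]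
      refine mul_le_mul_of_nonneg_right ?_ (sq_nonneg _)
      have : Real.exp (-σ * u) ≤ 1 := by
        rw [Real.exp_le_one_iff]
        have : 0 < σ * u := mul_pos hσ hu
        linarith
      calc |f u| * Real.exp (-σ * u) ≤ C * 1 := by gcongr; exact hC u
        _ = C := mul_one C
    · refine ae_of_all _ fun u => ?_
      have : Tendsto (fun σ : ℝ => f u * Real.exp (-σ * u) * Real.sinc (y - lam * u) ^ 2) (𝓝 0)
          (𝓝 (f u * Real.exp (-0 * u) * Real.sinc (y - lam * u) ^ 2)) := by
        apply Continuous.tendsto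
        fun_prop
      simp only [neg_zero, zero_mul, Real.exp_zero, mul_one] at this
      exact this.mono_left nhdsWithin_le_nhds
  refine tendsto_nhds_unique hL (hR.congr' ?_)
  filter_upwards [self_mem_nhdsWithin] with σ hσ
  exact (hpos σ hσ).symm

open MeasureTheory Filter Topology Set in
theorem tendsto_integral_fejer_boundary (G : ℂ → ℂ) (hG : ContinuousOn G {s | 0 ≤ s.re})
    (lam : ℝ) :
    Tendsto (fun y : ℝ => ∫ τ in (0 : ℝ)..2, (1 - τ / 2) *
      (Complex.exp (Complex.I * (τ * y : ℝ)) * G (Complex.I * (lam * τ : ℝ))).re) atTop (𝓝 0) := by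
  set g : ℝ → ℂ := fun τ => (1 - τ / 2 : ℝ) * G (Complex.I * (lam * τ : ℝ)) with hg
  have hgc : Continuous g := by
    have : Continuous fun τ : ℝ => G (Complex.I * (lam * τ : ℝ)) :=
      hG.comp_continuous (by fun_prop) fun τ => by simp
    exact Continuous.mul (by fun_prop) this
  have hw : Tendsto (fun y : ℝ => -(2 * Real.pi)⁻¹ * y) atTop (cocompact ℝ) := by
    have : Tendsto (fun y : ℝ => -(2 * Real.pi)⁻¹ * y) atTop atBot :=
      tendsto_id.const_mul_atTop_of_neg (by have := Real.pi_pos; simp; positivity)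
    exact this.mono_right atBot_le_cocompact
  have h := (Complex.continuous_re.tendsto 0).comp
    ((Real.tendsto_integral_exp_smul_cocompact ((Ioc (0 : ℝ) 2).indicator g)).comp hw)
  rw [Complex.zero_re] at h
  refine h.congr fun y => ?_
  simp only [Function.comp]
  have h1 : ∀ v : ℝ, Real.fourierChar (-(v * (-(2 * Real.pi)⁻¹ * y))) • (Ioc (0 : ℝ) 2).indicator g v
      = (Ioc (0 : ℝ) 2).indicator (fun τ => Complex.exp (Complex.I * (τ * y : ℝ)) * g τ) v := by
    intro v
    rw [Circle.smul_def, Real.fourierChar_apply]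
    by_cases hv : v ∈ Ioc (0 : ℝ) 2
    · rw [indicator_of_mem hv, indicator_of_mem hv, smul_eq_mul]
      congr 2
      have := Real.pi_ne_zero
      rw [mul_comm Complex.I]
      congr 2
      field_simp
    · rw [indicator_of_notMem hv, indicator_of_notMem hv, smul_zero]
  simp_rw [h1]
  rw [integral_indicator measurableSet_Ioc, ← RCLike.re_eq_complex_re, ← integral_re,
    intervalIntegral.integral_of_le (by norm_num)]
  · refine integral_congr_ae (ae_of_all _ fun τ => ?_)
    simp only [hg, RCLike.re_eq_complex_re]
    rw [mul_left_comm, Complex.re_ofReal_mul]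
  · exact (Continuous.integrableOn_Ioc (by fun_prop))

open MeasureTheory Filter Topology Set in
/-- The upper bound in the Wiener–Ikehara theorem, for bounded functions. -/
theorem eventually_le_of_laplace (B : ℝ → ℝ) (hB : Measurable B) {C : ℝ} (hB0 : ∀ u, 0 ≤ B u)
    (hC : ∀ u, B u ≤ C) (hmono : ∀ u v, u ≤ v → B u * Real.exp (-(v - u)) ≤ B v)
    (G : ℂ → ℂ) (hG : ContinuousOn G {s | 0 ≤ s.re})
    (hGf : ∀ s : ℂ, 0 < s.re →
      G s = ∫ u in Ioi (0 : ℝ), ((B u - 1 : ℝ) : ℂ) * Complex.exp (-s * u))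
    {ε : ℝ} (hε : 0 < ε) : ∀ᶠ x in atTop, B x ≤ 1 + ε := by
  set M : ℝ := ∫ v : ℝ, Real.sinc v ^ 2 with hM
  have hcs : Continuous fun v : ℝ => Real.sinc v ^ 2 := Real.continuous_sinc.pow 2
  have hMR : Tendsto (fun R : ℝ => ∫ v in (-R)..R, Real.sinc v ^ 2) atTop (𝓝 M) :=
    intervalIntegral_tendsto_integral integrable_sinc_sq tendsto_neg_atTop_atBot tendsto_id
  have hMpos : 0 < M := by
    refine integral_pos_of_integrable_nonneg_nonzero (x := 0) hcs integrable_sinc_sq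
      (fun v => sq_nonneg _) ?_
    simp
  obtain ⟨δ, hδ, hδe⟩ : ∃ δ > 0, Real.exp δ < 1 + ε := by
    refine ⟨Real.log (1 + ε) / 2, by have := Real.log_pos (by linarith : 1 < 1 + ε); positivity, ?_⟩
    rw [← Real.lt_log_iff_exp_lt (by linarith)]
    have := Real.log_pos (by linarith : 1 < 1 + ε)
    linarith
  obtain ⟨R, hR, hRe⟩ : ∃ R > 0, Real.exp δ * M < (1 + ε) * ∫ v in (-R)..R, Real.sinc v ^ 2 := by
    have h1 := (hMR.const_mul (1 + ε)).eventually
      (lt_mem_nhds (mul_lt_mul_of_pos_right hδe hMpos))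
    obtain ⟨R, h2, h3⟩ := (h1.and (eventually_gt_atTop 0)).exists
    exact ⟨R, h3, h2⟩
  set lam : ℝ := 2 * R / δ with hlamdef
  have hlam : 0 < lam := by positivity
  have hlamδ : lam * δ = 2 * R := by rw [hlamdef]; field_simp
  set J : ℝ → ℝ := fun y => ∫ τ in (0 : ℝ)..2, (1 - τ / 2) *
      (Complex.exp (Complex.I * (τ * y : ℝ)) * G (Complex.I * (lam * τ : ℝ))).re with hJ
  have hJ0 : Tendsto (fun x => Real.exp δ * (M + lam * J (lam * (x + δ / 2)))) atTop
      (𝓝 (Real.exp δ * (M + lam * 0))) := by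
    refine (((tendsto_integral_fejer_boundary G hG lam).comp ?_).const_mul lam |>.const_add M).const_mul _
    exact (tendsto_atTop_add_const_right _ _ tendsto_id).const_mul_atTop hlam
  rw [mul_zero, add_zero] at hJ0
  have hMRpos : 0 < ∫ v in (-R)..R, Real.sinc v ^ 2 := by
    have : 0 < Real.exp δ * M := by positivity
    nlinarith
  filter_upwards [hJ0.eventually (gt_mem_nhds hRe), eventually_ge_atTop 0] with x hx hx0
  suffices h : B x * ∫ v in (-R)..R, Real.sinc v ^ 2 ≤
      Real.exp δ * (M + lam * J (lam * (x + δ / 2))) by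
    exact le_of_mul_le_mul_right (h.trans hx.le) hMRpos
  set y := lam * (x + δ / 2) with hy
  have hsinc : Integrable (fun u : ℝ => Real.sinc (y - lam * u) ^ 2) :=
    ((integrable_sinc_sq.comp_sub_left y).comp_mul_left' hlam.ne')
  have hsm : Measurable Real.sinc := Real.continuous_sinc.measurable
  have hBs : Integrable (fun u : ℝ => B u * Real.sinc (y - lam * u) ^ 2) := by
    refine (hsinc.const_mul C).mono' (by fun_prop) (ae_of_all _ fun u => ?_)
    rw [Real.norm_of_nonneg (mul_nonneg (hB0 u) (sq_nonneg _))]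
    exact mul_le_mul_of_nonneg_right (hC u) (sq_nonneg _)
  have hJy : J y = (∫ u in Ioi (0 : ℝ), B u * Real.sinc (y - lam * u) ^ 2) -
      ∫ u in Ioi (0 : ℝ), Real.sinc (y - lam * u) ^ 2 := by
    rw [← integral_sub hBs.integrableOn hsinc.integrableOn, hJ]
    simp only
    have hC0 := (hB0 0).trans (hC 0)
    rw [integral_fejer_boundary (fun u => B u - 1) (hB.sub_const 1) (C := C + 1) _ G hG hGf hlam y]
    · refine integral_congr_ae (ae_of_all _ fun u => ?_)
      simp only; ring
    · intro u
      rw [abs_le]; constructor <;> linarith [hB0 u, hC u]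
  have hup : lam * ∫ u in Ioi (0 : ℝ), Real.sinc (y - lam * u) ^ 2 ≤ M := by
    have h1 : ∫ u in Ioi (0 : ℝ), Real.sinc (y - lam * u) ^ 2 ≤
        ∫ u, Real.sinc (y - lam * u) ^ 2 :=
      setIntegral_le_integral hsinc (ae_of_all _ fun u => sq_nonneg _)
    have h2 : ∫ u, Real.sinc (y - lam * u) ^ 2 = lam⁻¹ * M := by
      rw [Measure.integral_comp_mul_left (fun z => Real.sinc (y - z) ^ 2),
        integral_sub_left_eq_self (fun z => Real.sinc z ^ 2), abs_of_pos (by positivity),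
        smul_eq_mul]
    rw [h2] at h1
    calc lam * ∫ u in Ioi (0 : ℝ), Real.sinc (y - lam * u) ^ 2 ≤ lam * (lam⁻¹ * M) := by gcongr
      _ = M := by field_simp
  have hlow : B x * Real.exp (-δ) * ∫ v in (-R)..R, Real.sinc v ^ 2 ≤
      lam * ∫ u in Ioi (0 : ℝ), B u * Real.sinc (y - lam * u) ^ 2 := by
    have h1 : ∫ u in x..(x + δ), Real.sinc (y - lam * u) ^ 2 =
        lam⁻¹ * ∫ v in (-R)..R, Real.sinc v ^ 2 := by
      rw [intervalIntegral.integral_comp_sub_mul (fun v => Real.sinc v ^ 2) hlam.ne', smul_eq_mul]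
      congr 2
      · rw [hy]; linarith
      · rw [hy]; linarith
    have h2 : ∫ u in Ioc x (x + δ), B u * Real.sinc (y - lam * u) ^ 2 ≤
        ∫ u in Ioi (0 : ℝ), B u * Real.sinc (y - lam * u) ^ 2 :=
      setIntegral_mono_set hBs.integrableOn
        (ae_of_all _ fun u => mul_nonneg (hB0 u) (sq_nonneg _))
        (LE.le.eventuallyLE fun u hu => lt_of_le_of_lt hx0 hu.1)
    have h3 : ∫ u in Ioc x (x + δ), B x * Real.exp (-δ) * Real.sinc (y - lam * u) ^ 2 ≤
        ∫ u in Ioc x (x + δ), B u * Real.sinc (y - lam * u) ^ 2 := by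
      refine setIntegral_mono_on (hsinc.integrableOn.const_mul _) hBs.integrableOn
        measurableSet_Ioc fun u hu => mul_le_mul_of_nonneg_right ?_ (sq_nonneg _)
      refine le_trans (mul_le_mul_of_nonneg_left ?_ (hB0 x)) (hmono x u hu.1.le)
      exact Real.exp_le_exp.mpr (by linarith [hu.2])
    rw [integral_const_mul, ← intervalIntegral.integral_of_le (by linarith), h1] at h3
    calc _ = lam * (B x * Real.exp (-δ) * (lam⁻¹ * ∫ v in (-R)..R, Real.sinc v ^ 2)) := by
          field_simp
      _ ≤ _ := mul_le_mul_of_nonneg_left (h3.trans h2) hlam.le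
  have h4 : B x * Real.exp (-δ) * ∫ v in (-R)..R, Real.sinc v ^ 2 ≤ M + lam * J y := by
    rw [hJy, mul_sub]; linarith
  have h5 := mul_le_mul_of_nonneg_left h4 (Real.exp_pos δ).le
  have h6 : Real.exp δ * Real.exp (-δ) = 1 := by rw [← Real.exp_add]; simp
  calc _ = Real.exp δ * (B x * Real.exp (-δ) * ∫ v in (-R)..R, Real.sinc v ^ 2) := by
        linear_combination -(B x * ∫ v in (-R)..R, Real.sinc v ^ 2) * h6
    _ ≤ _ := h5

open MeasureTheory Set ArithmeticFunction.vonMangoldt in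
theorem LFunctionResidueClassAux_eq_integral_psi {s : ℂ} (hs : 0 < s.re) :
    (LFunctionResidueClassAux (1 : ZMod 1) (1 + s) - 1) / (1 + s) =
      ∫ u in Ioi (0 : ℝ), ((Chebyshev.psi (Real.exp u) * Real.exp (-u) - 1 : ℝ) : ℂ) *
        Complex.exp (-s * u) := by
  have hs0 : s ≠ 0 := fun h => by simp [h] at hs
  have hs1 : 1 + s ≠ 0 := fun h => by
    have := congrArg Complex.re h
    simp at this; linarith
  have hres : ∀ n : ℕ, residueClass (1 : ZMod 1) n = ArithmeticFunction.vonMangoldt n := by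
    intro n
    rw [residueClass, indicator_of_mem]
    exact Subsingleton.elim (α := ZMod 1) _ _
  have hL : LFunctionResidueClassAux (1 : ZMod 1) (1 + s) =
      LSeries (fun n => (ArithmeticFunction.vonMangoldt n : ℂ)) (1 + s) - 1 / s := by
    rw [eqOn_LFunctionResidueClassAux isUnit_one (by simpa using hs)]
    simp only [hres]
    simp
  have hO : (fun n : ℕ => ∑ k ∈ Finset.Icc 1 n, ArithmeticFunction.vonMangoldt k)
      =O[Filter.atTop] fun n => (n : ℝ) ^ (1 : ℝ) := by
    refine Asymptotics.IsBigO.of_bound (Real.log 4 + 4) (Filter.Eventually.of_forall fun n => ?_)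
    have h := Chebyshev.psi_le_const_mul_self (x := (n : ℝ)) (Nat.cast_nonneg n)
    rw [Chebyshev.psi, Nat.floor_natCast] at h
    rw [Real.rpow_one, Real.norm_of_nonneg
      (Finset.sum_nonneg fun _ _ => ArithmeticFunction.vonMangoldt_nonneg), Real.norm_natCast]
    exact h
  have h_int : LSeries (fun n => (ArithmeticFunction.vonMangoldt n : ℂ)) (1 + s) =
      (1 + s) * ∫ u in Ioi (0 : ℝ), ((Chebyshev.psi (Real.exp u) * Real.exp (-u) : ℝ) : ℂ) *
        Complex.exp (-s * u) := by
    rw [LSeries_eq_mul_integral_of_nonneg _ zero_le_one (by simpa using hs) hO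
      fun _ => ArithmeticFunction.vonMangoldt_nonneg]
    congr 1
    rw [← Real.exp_zero, ← integral_comp_exp_Ioi]
    refine setIntegral_congr_fun measurableSet_Ioi fun u _ => ?_
    have hpsi : ∑ k ∈ Finset.Icc 1 ⌊Real.exp u⌋₊, (ArithmeticFunction.vonMangoldt k : ℂ) =
        (Chebyshev.psi (Real.exp u) : ℂ) := by
      rw [Chebyshev.psi]; push_cast; rfl
    rw [hpsi, Complex.cpow_def_of_ne_zero (by simp), ← Complex.ofReal_log
      (Real.exp_pos u).le, Real.log_exp, Complex.real_smul]
    push_cast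
    rw [mul_left_comm, ← Complex.exp_add, mul_assoc, ← Complex.exp_add]
    congr 2
    ring
  have hone : ∫ u in Ioi (0 : ℝ), Complex.exp (-s * u) = 1 / s := by
    rw [integral_exp_mul_complex_Ioi (by simpa using hs)]
    simp
  have hexp : ∀ C : ℝ, Integrable (fun u : ℝ => C * Real.exp (-s.re * u))
      (volume.restrict (Ioi 0)) := fun C =>
    ((exp_neg_integrableOn_Ioi 0 hs).integrable).const_mul C
  have hm : Measurable fun u => Chebyshev.psi (Real.exp u) :=
    (Chebyshev.psi_mono.comp Real.exp_monotone).measurable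
  have hi1 : Integrable (fun u : ℝ => ((Chebyshev.psi (Real.exp u) * Real.exp (-u) : ℝ) : ℂ) *
        Complex.exp (-s * u)) (volume.restrict (Ioi 0)) := by
    refine (hexp (Real.log 4 + 4)).mono' (by fun_prop) (ae_of_all _ fun u => ?_)
    rw [norm_mul, Complex.norm_exp, Complex.norm_real, Real.norm_of_nonneg
      (mul_nonneg (Chebyshev.psi_nonneg _) (Real.exp_pos _).le)]
    have : (-s * (u : ℂ)).re = -s.re * u := by simp
    rw [this]
    refine mul_le_mul_of_nonneg_right ?_ (Real.exp_pos _).le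
    rw [Real.exp_neg, ← div_eq_mul_inv, div_le_iff₀ (Real.exp_pos u)]
    exact Chebyshev.psi_le_const_mul_self (Real.exp_pos u).le
  have hi2 : Integrable (fun u : ℝ => Complex.exp (-s * u)) (volume.restrict (Ioi 0)) := by
    refine (hexp 1).mono' (by fun_prop) (ae_of_all _ fun u => ?_)
    rw [Complex.norm_exp]
    simp
  have hsub : ∫ u in Ioi (0 : ℝ), ((Chebyshev.psi (Real.exp u) * Real.exp (-u) - 1 : ℝ) : ℂ) *
        Complex.exp (-s * u) = (∫ u in Ioi (0 : ℝ),
          ((Chebyshev.psi (Real.exp u) * Real.exp (-u) : ℝ) : ℂ) * Complex.exp (-s * u)) - 1 / s := by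
    rw [← hone, ← integral_sub hi1 hi2]
    refine integral_congr_ae (Filter.Eventually.of_forall fun u => ?_)
    simp only
    push_cast
    ring
  rw [hsub, hL, h_int]
  field_simp
  ring

open Filter in
/-- The upper bound in the prime number theorem, for the Chebyshev function `ψ`. -/
theorem Chebyshev.eventually_psi_le {δ : ℝ} (hδ : 0 < δ) :
    ∀ᶠ x in atTop, Chebyshev.psi x ≤ (1 + δ) * x := by
  have hm : Measurable fun u => Chebyshev.psi (Real.exp u) :=
    (Chebyshev.psi_mono.comp Real.exp_monotone).measurable
  have h := eventually_le_of_laplace (fun u => Chebyshev.psi (Real.exp u) * Real.exp (-u))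
    (by fun_prop) (C := Real.log 4 + 4)
    (fun u => mul_nonneg (Chebyshev.psi_nonneg _) (Real.exp_pos _).le)
    (fun u => by
      rw [Real.exp_neg, ← div_eq_mul_inv, div_le_iff₀ (Real.exp_pos u)]
      exact Chebyshev.psi_le_const_mul_self (Real.exp_pos u).le)
    (fun u v huv => by
      rw [mul_assoc, ← Real.exp_add]
      have : -u + -(v - u) = -v := by ring
      rw [this]
      exact mul_le_mul_of_nonneg_right (Chebyshev.psi_mono (Real.exp_le_exp.mpr huv))
        (Real.exp_pos _).le)
    (fun s => (ArithmeticFunction.vonMangoldt.LFunctionResidueClassAux (1 : ZMod 1) (1 + s) - 1)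
      / (1 + s))
    (by
      refine ContinuousOn.div (ContinuousOn.sub ?_ continuousOn_const) (by fun_prop) ?_
      · exact (ArithmeticFunction.vonMangoldt.continuousOn_LFunctionResidueClassAux 1).comp
          (by fun_prop) fun s hs => by simpa using hs
      · intro s hs h
        have h1 := congrArg Complex.re h
        simp at h1 hs
        linarith)
    (fun s hs => LFunctionResidueClassAux_eq_integral_psi hs) hδ
  filter_upwards [Real.tendsto_log_atTop.eventually h, eventually_gt_atTop 0] with x hx hx0
  rwa [Real.exp_neg, Real.exp_log hx0, ← div_eq_mul_inv, div_le_iff₀ hx0] at hx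

open Filter in
theorem Chebyshev.eventually_lcmUpto_le {δ : ℝ} (hδ : 0 < δ) :
    ∀ᶠ n : ℕ in atTop, (Nat.lcmUpto n : ℝ) ≤ Real.exp ((1 + δ) * n) := by
  filter_upwards [tendsto_natCast_atTop_atTop.eventually (Chebyshev.eventually_psi_le hδ)]
    with n hn
  rw [Chebyshev.psi_eq_log_lcmUpto] at hn
  exact (Real.log_le_iff_le_exp (by exact_mod_cast Nat.lcmUpto_pos n)).mp hn

open Finset in
/-- `f` has a partial fraction expansion with poles of order at most `a` at `0, -1, …, -n`, whose
coefficients have controlled denominators and total size at most `M`. -/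
def HasPartialFractions (d n a : ℕ) (M : ℝ) (f : ℝ → ℝ) : Prop :=
  ∃ c : ℕ → ℕ → ℝ,
    (∀ l ∈ Icc 1 a, ∀ j ∈ range (n + 1), ∃ z : ℤ, (d : ℝ) ^ (a - l) * c l j = z) ∧
    (∀ t : ℝ, (∀ j ∈ range (n + 1), t + j ≠ 0) →
      f t = ∑ l ∈ Icc 1 a, ∑ j ∈ range (n + 1), c l j / (t + j) ^ l) ∧
    ∑ l ∈ Icc 1 a, ∑ j ∈ range (n + 1), |c l j| ≤ M

namespace HasPartialFractions

open Finset

variable {d n a : ℕ} {M M' : ℝ} {f g : ℝ → ℝ}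

theorem mono (hf : HasPartialFractions d n a M f) (h : M ≤ M') :
    HasPartialFractions d n a M' f := by
  obtain ⟨c, h1, h2, h3⟩ := hf
  exact ⟨c, h1, h2, h3.trans h⟩

theorem nonneg (hf : HasPartialFractions d n a M f) : 0 ≤ M := by
  obtain ⟨c, -, -, h3⟩ := hf
  exact le_trans (sum_nonneg fun _ _ => sum_nonneg fun _ _ => abs_nonneg _) h3

theorem congr (hf : HasPartialFractions d n a M f)
    (h : ∀ t : ℝ, (∀ j ∈ range (n + 1), t + j ≠ 0) → g t = f t) :
    HasPartialFractions d n a M g := by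
  obtain ⟨c, h1, h2, h3⟩ := hf
  exact ⟨c, h1, fun t ht => (h t ht).trans (h2 t ht), h3⟩

theorem zero : HasPartialFractions d n a 0 (fun _ => 0) :=
  ⟨fun _ _ => 0, fun _ _ _ _ => ⟨0, by simp⟩, by simp, by simp⟩

theorem add (hf : HasPartialFractions d n a M f) (hg : HasPartialFractions d n a M' g) :
    HasPartialFractions d n a (M + M') (fun t => f t + g t) := by
  obtain ⟨c, h1, h2, h3⟩ := hf
  obtain ⟨c', h1', h2', h3'⟩ := hg
  refine ⟨fun l j => c l j + c' l j, fun l hl j hj => ?_, fun t ht => ?_, ?_⟩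
  · obtain ⟨z, hz⟩ := h1 l hl j hj
    obtain ⟨z', hz'⟩ := h1' l hl j hj
    exact ⟨z + z', by push_cast; rw [← hz, ← hz']; ring⟩
  · simp only [h2 t ht, h2' t ht, add_div, sum_add_distrib]
  · refine le_trans ?_ (add_le_add h3 h3')
    simp only [← sum_add_distrib]
    exact sum_le_sum fun _ _ => sum_le_sum fun _ _ => abs_add_le _ _

theorem sum {ι : Type*} (s : Finset ι) {M : ι → ℝ} {f : ι → ℝ → ℝ}
    (h : ∀ i ∈ s, HasPartialFractions d n a (M i) (f i)) :
    HasPartialFractions d n a (∑ i ∈ s, M i) (fun t => ∑ i ∈ s, f i t) := by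
  classical
  induction s using Finset.induction_on with
  | empty => simpa using zero
  | insert i s hi ih =>
    simp only [sum_insert hi]
    exact (h i (mem_insert_self i s)).add (ih fun j hj => h j (mem_insert_of_mem hj))

theorem single {l j : ℕ} (hl : l ∈ Icc 1 a) (hj : j ∈ range (n + 1)) {x : ℝ}
    (hx : ∃ z : ℤ, (d : ℝ) ^ (a - l) * x = z) :
    HasPartialFractions d n a |x| (fun t => x / (t + j) ^ l) := by
  refine ⟨fun l' j' => if l' = l ∧ j' = j then x else 0, fun l' _ j' _ => ?_, fun t _ => ?_, ?_⟩
  · by_cases h : l' = l ∧ j' = j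
    · simpa [h] using hx
    · exact ⟨0, by simp [h]⟩
  · rw [sum_eq_single_of_mem l hl, sum_eq_single_of_mem j hj]
    · simp
    · intro b _ hb; simp [hb]
    · intro b _ hb; simp [hb]
  · rw [sum_eq_single_of_mem l hl, sum_eq_single_of_mem j hj]
    · simp
    · intro b _ hb; simp [hb]
    · intro b _ hb; simp [hb]

theorem div_mul_linear (hd : ∀ m ∈ Icc 1 n, m ∣ d) {j p : ℕ} (hj : j ∈ range (n + 1))
    (hp : p ∈ range (n + 1)) {l : ℕ} (hl : l ≤ a) {x : ℝ}
    (hx : ∃ z : ℤ, (d : ℝ) ^ (a - l) * x = z) :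
    HasPartialFractions d n (a + 1) ((l + 1) * |x|) (fun t => x / (t + j) ^ l / (t + p)) := by
  rcases eq_or_ne p j with rfl | hpj
  · refine ((single (a := a + 1) (l := l + 1) (by simp; omega) hp (x := x) ?_).congr
      fun t ht => ?_).mono ?_
    · simpa using hx
    · rw [pow_succ, div_div]
    · nlinarith [abs_nonneg x, (Nat.cast_nonneg l : (0 : ℝ) ≤ l)]
  obtain ⟨w, hw⟩ : ∃ w : ℤ, (d : ℝ) / (p - j) = w := by
    have h1 : ((p : ℤ) - j) ∣ d := by
      rw [← Int.natAbs_dvd_natAbs, Int.natAbs_natCast]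
      apply hd
      simp only [mem_range, mem_Icc] at *
      omega
    obtain ⟨w, hw⟩ := h1
    refine ⟨w, ?_⟩
    have h2 : (p : ℝ) - j ≠ 0 := sub_ne_zero.mpr (by exact_mod_cast hpj)
    rw [div_eq_iff h2]
    have := congrArg (Int.cast (R := ℝ)) hw
    push_cast at this
    rw [this, mul_comm]
  have h2 : (p : ℝ) - j ≠ 0 := sub_ne_zero.mpr (by exact_mod_cast hpj)
  have habs : ∀ x : ℝ, |x / (p - j)| ≤ |x| := by
    intro x
    rw [abs_div]
    refine div_le_self (abs_nonneg x) ?_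
    have : (1 : ℤ) ≤ |(p : ℤ) - j| := Int.one_le_abs (sub_ne_zero.mpr (by exact_mod_cast hpj))
    exact_mod_cast this
  induction l generalizing x with
  | zero =>
    refine ((single (a := a + 1) (l := 1) (by simp) hp (x := x) ?_).congr fun t ht => ?_).mono ?_
    · simpa using hx
    · simp
    · simp
  | succ l ih =>
    have hx' : ∃ z : ℤ, (d : ℝ) ^ (a - l) * (x / (p - j)) = z := by
      obtain ⟨z, hz⟩ := hx
      refine ⟨z * w, ?_⟩
      push_cast
      rw [← hz, ← hw, show a - l = a - (l + 1) + 1 by omega, pow_succ]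
      ring
    have hA := single (d := d) (n := n) (a := a + 1) (l := l + 1) (by simp; omega) hj
      (x := x / (p - j)) (by simpa using hx')
    have hx'' : ∃ z : ℤ, (d : ℝ) ^ (a - l) * (-(x / (p - j))) = z := by
      obtain ⟨z, hz⟩ := hx'
      exact ⟨-z, by push_cast; rw [← hz]; ring⟩
    refine ((hA.add (ih (by omega) hx'')).congr fun t ht => ?_).mono ?_
    · have hj' := ht j hj
      have hp' := ht p hp
      field_simp
      ring
    · rw [abs_neg]
      push_cast
      nlinarith [habs x, abs_nonneg x, (Nat.cast_nonneg l : (0 : ℝ) ≤ l)]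

theorem mul (hd : ∀ m ∈ Icc 1 n, m ∣ d) (hf : HasPartialFractions d n a M f) {A : ℕ → ℤ} {W : ℝ}
    (hg : ∀ t : ℝ, (∀ j ∈ range (n + 1), t + j ≠ 0) →
      g t = ∑ p ∈ range (n + 1), A p / (t + p)) (hA : ∑ p ∈ range (n + 1), |(A p : ℝ)| ≤ W) :
    HasPartialFractions d n (a + 1) ((a + 1) * M * W) (fun t => f t * g t) := by
  have hM := hf.nonneg
  obtain ⟨c, h1, h2, h3⟩ := hf
  have key : HasPartialFractions d n (a + 1)
      (∑ l ∈ Icc 1 a, ∑ j ∈ range (n + 1), ∑ p ∈ range (n + 1), ((l : ℝ) + 1) * |c l j * A p|)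
      (fun t => ∑ l ∈ Icc 1 a, ∑ j ∈ range (n + 1), ∑ p ∈ range (n + 1),
        c l j * A p / (t + j) ^ l / (t + p)) := by
    refine sum _ fun l hl => sum _ fun j hj => sum _ fun p hp =>
      div_mul_linear hd hj hp (mem_Icc.mp hl).2 ?_
    obtain ⟨z, hz⟩ := h1 l hl j hj
    exact ⟨z * A p, by push_cast; rw [← hz]; ring⟩
  refine (key.congr fun t ht => ?_).mono ?_
  · rw [h2 t ht, hg t ht, sum_mul]
    refine sum_congr rfl fun l _ => ?_
    rw [sum_mul]
    refine sum_congr rfl fun j _ => ?_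
    rw [mul_sum]
    refine sum_congr rfl fun p _ => ?_
    ring
  · calc _ ≤ ∑ l ∈ Icc 1 a, ∑ j ∈ range (n + 1), ∑ p ∈ range (n + 1),
          ((a : ℝ) + 1) * (|c l j| * |(A p : ℝ)|) := by
          refine sum_le_sum fun l hl => sum_le_sum fun j _ => sum_le_sum fun p _ => ?_
          rw [abs_mul]
          have : (l : ℝ) ≤ a := by exact_mod_cast (mem_Icc.mp hl).2
          gcongr
      _ = (a + 1) * (∑ l ∈ Icc 1 a, ∑ j ∈ range (n + 1), |c l j|) *
          ∑ p ∈ range (n + 1), |(A p : ℝ)| := by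
          simp only [← mul_sum, ← sum_mul]
          ring
      _ ≤ _ := by
          refine mul_le_mul (mul_le_mul_of_nonneg_left h3 (by positivity)) hA
            (sum_nonneg fun _ _ => abs_nonneg _) (by positivity)

end HasPartialFractions

open Finset in
theorem prod_range_sub_cast_self (p : ℕ) : ∏ q ∈ range p, ((q : ℝ) - p) = (-1) ^ p * p.factorial := by
  rw [← prod_range_reflect, ← Finset.prod_range_add_one_eq_factorial]
  push_cast
  have : ((-1 : ℝ)) ^ p = ∏ _q ∈ range p, (-1 : ℝ) := by simp
  rw [this, ← prod_mul_distrib]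
  refine prod_congr rfl fun q hq => ?_
  have hq := mem_range.mp hq
  rw [Nat.sub_sub, Nat.cast_sub (by omega)]
  push_cast
  ring

open Finset in
theorem prod_erase_range_sub {n p : ℕ} (hp : p ≤ n) :
    ∏ q ∈ (range (n + 1)).erase p, ((q : ℝ) - p) =
      (-1) ^ p * p.factorial * (n - p).factorial := by
  induction n, hp using Nat.le_induction with
  | base => rw [range_add_one, erase_insert (by simp), prod_range_sub_cast_self]; simp
  | succ n hn ih =>
    rw [range_add_one, erase_insert_of_ne (by omega), prod_insert (by simp), ih,
      Nat.succ_sub hn, Nat.factorial_succ]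
    push_cast [Nat.cast_sub hn]
    ring

open Finset Polynomial in
/-- Partial fractions of `P / ((t)(t+1)⋯(t+n))` when `P` takes values divisible by `n!` at the
poles. -/
theorem exists_partialFractions_of_dvd {n : ℕ} (P : ℝ[X]) (hP : P.natDegree ≤ n) {W : ℝ}
    (hW : ∀ p ∈ range (n + 1), ∃ z : ℤ, P.eval (-(p : ℝ)) = n.factorial * z ∧ |(z : ℝ)| ≤ W) :
    ∃ A : ℕ → ℤ, (∀ t : ℝ, (∀ j ∈ range (n + 1), t + j ≠ 0) →
      P.eval t / ∏ j ∈ range (n + 1), (t + j) = ∑ p ∈ range (n + 1), A p / (t + p)) ∧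
      ∑ p ∈ range (n + 1), |(A p : ℝ)| ≤ 2 ^ n * W := by
  choose! z hz hzW using hW
  refine ⟨fun p => (-1) ^ p * n.choose p * z p, fun t ht => ?_, ?_⟩
  · have hinj : Set.InjOn (fun j : ℕ => -(j : ℝ)) (range (n + 1)) := by
      intro a _ b _ h; simpa using h
    have hdeg : P.degree < #(range (n + 1)) := by
      rw [card_range]
      exact lt_of_le_of_lt degree_le_natDegree (by exact_mod_cast Nat.lt_succ_of_le hP)
    have hnod : (Lagrange.nodal (range (n + 1)) fun j : ℕ => -(j : ℝ)).eval t =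
        ∏ j ∈ range (n + 1), (t + j) := by
      rw [Lagrange.eval_nodal]; simp
    conv_lhs => rw [Lagrange.eq_interpolate hinj hdeg]
    rw [Lagrange.eval_interpolate_not_at_node _ fun i hi h => ht i hi (by rw [h]; ring), hnod,
      mul_div_cancel_left₀ _ (prod_ne_zero_iff.mpr ht)]
    refine sum_congr rfl fun p hp => ?_
    have hpn : p ≤ n := by simpa [Nat.lt_succ_iff] using hp
    have hw : Lagrange.nodalWeight (range (n + 1)) (fun j : ℕ => -(j : ℝ)) p =
        ((-1 : ℝ) ^ p * p.factorial * (n - p).factorial)⁻¹ := by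
      rw [Lagrange.nodalWeight, prod_inv_distrib, ← prod_erase_range_sub hpn]
      congr 1
      exact prod_congr rfl fun q _ => by ring
    rw [hw, hz p hp]
    have hc : (n.choose p : ℝ) * p.factorial * (n - p).factorial = n.factorial := by
      exact_mod_cast Nat.choose_mul_factorial_mul_factorial hpn
    have h1 : ((-1 : ℝ) ^ p) * (-1) ^ p = 1 := by rw [← mul_pow]; simp
    have := ht p hp
    push_cast
    rw [sub_neg_eq_add, ← hc]
    field_simp
    linear_combination -(z p : ℝ) * (n.choose p : ℝ) * h1
  · have : (2 : ℝ) ^ n = ∑ p ∈ range (n + 1), (n.choose p : ℝ) := by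
      exact_mod_cast (Nat.sum_range_choose n).symm
    rw [this, sum_mul]
    refine sum_le_sum fun p hp => ?_
    push_cast
    rw [abs_mul, abs_mul, abs_pow, abs_neg, abs_one, one_pow, one_mul, Nat.abs_cast]
    exact mul_le_mul_of_nonneg_left (hzW p hp) (Nat.cast_nonneg _)

open Finset in
theorem exists_partialFractions_factorial (n : ℕ) :
    ∃ A : ℕ → ℤ, (∀ t : ℝ, (∀ j ∈ range (n + 1), t + j ≠ 0) →
      n.factorial / ∏ j ∈ range (n + 1), (t + j) = ∑ p ∈ range (n + 1), A p / (t + p)) ∧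
      ∑ p ∈ range (n + 1), |(A p : ℝ)| ≤ 2 ^ n := by
  have := exists_partialFractions_of_dvd (n := n) (Polynomial.C (n.factorial : ℝ)) (by simp) (W := 1)
    fun p _ => ⟨1, by simp⟩
  simpa using this

theorem pow_self_le_three_pow_mul_factorial (n : ℕ) : (n : ℝ) ^ n ≤ 3 ^ n * n.factorial := by
  have h := Real.pow_div_factorial_le_exp (x := (n : ℝ)) (Nat.cast_nonneg n) n
  have h2 : Real.exp n ≤ 3 ^ n := by
    rw [← mul_one (n : ℝ), Real.exp_nat_mul]
    exact pow_le_pow_left₀ (Real.exp_pos _).le Real.exp_one_lt_three.le n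
  rw [div_le_iff₀ (by positivity)] at h
  exact h.trans (by gcongr)

open Finset in
theorem exists_partialFractions_prod (n r : ℕ) (e : ℤ)
    (he : ∀ p ∈ range (n + 1), ∀ i ∈ range n, |e - p + i| ≤ (r + 1) * n) :
    ∃ A : ℕ → ℤ, (∀ t : ℝ, (∀ j ∈ range (n + 1), t + j ≠ 0) →
      (∏ i ∈ range n, (t + e + i)) / ∏ j ∈ range (n + 1), (t + j) =
        ∑ p ∈ range (n + 1), A p / (t + p)) ∧
      ∑ p ∈ range (n + 1), |(A p : ℝ)| ≤ 2 ^ n * (3 * (r + 1)) ^ n := by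
  have := exists_partialFractions_of_dvd (n := n)
    (∏ i ∈ range n, (Polynomial.X + Polynomial.C ((e + i : ℤ) : ℝ)))
    ((Polynomial.natDegree_prod_le _ _).trans (by
      simp only [Polynomial.natDegree_X_add_C]; simp)) (W := (3 * (r + 1)) ^ n)
    fun p hp => by
      obtain ⟨z, hz⟩ := Nat.factorial_coe_dvd_prod n (e - p)
      have hz' : ∏ i ∈ range n, ((e : ℝ) - p + i) = n.factorial * z := by exact_mod_cast hz
      refine ⟨z, ?_, ?_⟩
      · rw [← hz', Polynomial.eval_prod]
        refine prod_congr rfl fun i _ => ?_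
        simp
        ring
      · have hn : (0 : ℝ) < n.factorial := by positivity
        refine le_of_mul_le_mul_left ?_ hn
        calc (n.factorial : ℝ) * |(z : ℝ)| = |∏ i ∈ range n, ((e : ℝ) - p + i)| := by
              rw [hz', abs_mul, Nat.abs_cast]
          _ = ∏ i ∈ range n, |(e : ℝ) - p + i| := abs_prod _ _
          _ ≤ ∏ i ∈ range n, (((r : ℝ) + 1) * n) := by
              refine prod_le_prod (fun _ _ => abs_nonneg _) fun i hi => ?_
              exact_mod_cast he p hp i hi
          _ = (r + 1) ^ n * (n : ℝ) ^ n := by simp [mul_pow]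
          _ ≤ (r + 1) ^ n * (3 ^ n * n.factorial) :=
              mul_le_mul_of_nonneg_left (pow_self_le_three_pow_mul_factorial n) (by positivity)
          _ = _ := by rw [mul_pow]; ring
  obtain ⟨A, h1, h2⟩ := this
  refine ⟨A, fun t ht => ?_, h2⟩
  rw [← h1 t ht, Polynomial.eval_prod]
  congr 1
  refine prod_congr rfl fun i _ => ?_
  simp
  ring

section LinearForm

open Finset Filter Topology

theorem hasSum_one_div_add_pow {l : ℕ} (hl : 1 ≤ l) (j : ℕ) :
    HasSum (fun k : ℕ => 1 / ((k : ℝ) + 1 + j) ^ l - 0 ^ (l - 1) / (k + 1))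
      ((if l = 1 then 0 else zetaVal l) - ∑ i ∈ range j, 1 / ((i : ℝ) + 1) ^ l) := by
  induction j with
  | zero =>
    rcases eq_or_ne l 1 with rfl | h1
    · simp
    · have hs : Summable fun k : ℕ => 1 / ((k : ℝ) + 1) ^ l := by
        have := (summable_nat_add_iff 1).mpr (Real.summable_one_div_nat_pow.mpr (by omega : 1 < l))
        exact_mod_cast this
      have h0 : (0 : ℝ) ^ (l - 1) = 0 := zero_pow (by omega)
      simpa [h1, h0, zetaVal] using hs.hasSum
  | succ j ih =>
    set u : ℕ → ℝ := fun k => 1 / ((k : ℝ) + 1 + j) ^ l with hu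
    have hu0 : Tendsto u atTop (𝓝 0) := by
      have h1 : Tendsto (fun k : ℕ => 1 / ((k : ℝ) + 1 + j)) atTop (𝓝 0) := by
        have := (tendsto_one_div_add_atTop_nhds_zero_nat (𝕜 := ℝ)).comp (tendsto_add_atTop_nat j)
        refine this.congr fun k => ?_
        simp only [Function.comp]
        push_cast
        ring_nf
      have := h1.pow l
      rw [zero_pow (by omega)] at this
      refine this.congr fun k => ?_
      rw [hu, div_pow, one_pow]
    have htel : HasSum (fun k => u k - u (k + 1)) (u 0) := by
      rw [hasSum_iff_tendsto_nat_of_nonneg]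
      · simp_rw [sum_range_sub']
        simpa using hu0.const_sub (u 0)
      · intro k
        rw [hu, sub_nonneg]
        simp only
        push_cast
        gcongr
        linarith
    have hfun : (fun k : ℕ => 1 / ((k : ℝ) + 1 + (j + 1 : ℕ)) ^ l - 0 ^ (l - 1) / (k + 1)) =
        fun k : ℕ => (1 / ((k : ℝ) + 1 + j) ^ l - 0 ^ (l - 1) / (k + 1)) - (u k - u (k + 1)) := by
      funext k
      simp only [hu]
      push_cast
      ring_nf
    have hu00 : 1 / ((j : ℝ) + 1) ^ l = u 0 := by
      simp only [hu]
      push_cast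
      ring_nf
    rw [hfun, sum_range_succ, ← sub_sub, hu00]
    exact ih.sub htel

namespace HasPartialFractions

variable {d n a : ℕ} {M : ℝ} {f : ℝ → ℝ}

theorem exists_linearForm (hd : ∀ m ∈ Icc 1 n, m ∣ d) (hf : HasPartialFractions d n a M f)
    (hsymm : ∀ k : ℕ, 0 < k → f (-n - k) = -f k)
    (hlim : Tendsto (fun k : ℕ => (k : ℝ) * f k) atTop (𝓝 0)) :
    ∃ P : ℕ → ℤ, (∀ l ≤ a, |(P l : ℝ)| ≤ 2 * d ^ a * M * (n + 1)) ∧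
      HasSum (fun k : ℕ => 2 * (d : ℝ) ^ a * f (k + 1))
        (P 0 + ∑ l ∈ Icc 3 a with Odd l, P l * zetaVal l) := by
  have hM := hf.nonneg
  obtain ⟨c, h1, h2, h3⟩ := hf
  set C : ℕ → ℕ → ℝ := fun l j => c l j - (-1) ^ l * c l (n - j) with hCdef
  have hrefl : ∀ g : ℕ → ℝ, ∑ j ∈ range (n + 1), g (n - j) = ∑ j ∈ range (n + 1), g j := by
    intro g
    rw [← sum_range_reflect g]
    simp
  have hC : ∀ l ∈ Icc 1 a, ∀ j ∈ range (n + 1), ∃ z : ℤ, (d : ℝ) ^ (a - l) * C l j = z := by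
    intro l hl j hj
    obtain ⟨z, hz⟩ := h1 l hl j hj
    obtain ⟨z', hz'⟩ := h1 l hl (n - j) (by simp)
    exact ⟨z - (-1) ^ l * z', by push_cast; rw [← hz, ← hz', hCdef]; ring⟩
  have hf2 : ∀ k : ℕ, 0 < k → 2 * f k = ∑ l ∈ Icc 1 a, ∑ j ∈ range (n + 1), C l j / (k + j) ^ l := by
    intro k hk
    have hk' : (0 : ℝ) < k := by exact_mod_cast hk
    have e1 := h2 k fun j _ => by positivity
    have e2 := h2 (-n - k) fun j hj => by
      have : (j : ℝ) ≤ n := by exact_mod_cast Nat.lt_succ_iff.mp (mem_range.mp hj)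
      linarith
    rw [hsymm k hk] at e2
    have : 2 * f k = f k - -f k := by ring
    rw [this, e2, e1, ← sum_sub_distrib]
    refine sum_congr rfl fun l _ => ?_
    rw [← hrefl fun j => c l j / (-n - k + j) ^ l, ← sum_sub_distrib]
    refine sum_congr rfl fun j hj => ?_
    have hjn : j ≤ n := Nat.lt_succ_iff.mp (mem_range.mp hj)
    have : (-n - k + ((n - j : ℕ) : ℝ)) = -1 * (k + j) := by rw [Nat.cast_sub hjn]; ring
    rw [this, mul_pow]
    have h1 : ((-1 : ℝ) ^ l) * (-1) ^ l = 1 := by rw [← mul_pow]; simp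
    have h2 : ((-1 : ℝ) ^ l) ≠ 0 := by simp
    have h3 : (k : ℝ) + j ≠ 0 := by positivity
    rw [hCdef]
    field_simp
    linear_combination c l (n - j) * h1
  set B : ℕ → ℝ := fun l => ∑ j ∈ range (n + 1), C l j with hBdef
  have hBeven : ∀ l, Even l → B l = 0 := by
    intro l hl
    simp only [hBdef, hCdef, hl.neg_one_pow, one_mul, sum_sub_distrib]
    rw [hrefl, sub_self]
  have hB1 : ∑ l ∈ Icc 1 a, 0 ^ (l - 1) * B l = 0 := by
    have hk : ∀ l ∈ Icc 1 a, ∀ j : ℕ, Tendsto (fun k : ℕ => (k : ℝ) / (k + j) ^ l) atTop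
        (𝓝 (0 ^ (l - 1))) := by
      intro l hl j
      have e1 := tendsto_natCast_div_add_atTop (𝕜 := ℝ) (j : ℝ)
      have e2 : Tendsto (fun k : ℕ => 1 / ((k : ℝ) + j)) atTop (𝓝 0) :=
        (tendsto_atTop_add_const_right _ _ tendsto_natCast_atTop_atTop).const_div_atTop 1
      have := e1.mul (e2.pow (l - 1))
      rw [one_mul] at this
      refine this.congr fun k => ?_
      obtain ⟨m, rfl⟩ := Nat.exists_eq_add_of_le (mem_Icc.mp hl).1
      rw [Nat.add_sub_cancel_left, pow_add, pow_one, div_pow, one_pow, div_mul_div_comm, mul_one]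
    have e1 : Tendsto (fun k : ℕ => ∑ l ∈ Icc 1 a, ∑ j ∈ range (n + 1),
        C l j * ((k : ℝ) / (k + j) ^ l)) atTop
        (𝓝 (∑ l ∈ Icc 1 a, ∑ j ∈ range (n + 1), C l j * 0 ^ (l - 1))) :=
      tendsto_finsetSum _ fun l hl => tendsto_finsetSum _ fun j _ => (hk l hl j).const_mul _
    have e2 : Tendsto (fun k : ℕ => ∑ l ∈ Icc 1 a, ∑ j ∈ range (n + 1),
        C l j * ((k : ℝ) / (k + j) ^ l)) atTop (𝓝 (2 * 0)) := by
      refine (hlim.const_mul 2).congr' ?_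
      filter_upwards [eventually_gt_atTop 0] with k hk
      rw [mul_left_comm, hf2 k hk, mul_sum]
      refine sum_congr rfl fun l _ => ?_
      rw [mul_sum]
      exact sum_congr rfl fun j _ => by ring
    have := tendsto_nhds_unique e1 e2
    rw [mul_zero] at this
    refine Eq.trans (sum_congr rfl fun l _ => ?_) this
    rw [← sum_mul, mul_comm]
  have hd0 : ∀ l, ∀ j ∈ range (n + 1), ∃ w : ℤ,
      (d : ℝ) ^ l * ∑ i ∈ range j, 1 / ((i : ℝ) + 1) ^ l = w := by
    intro l j hj
    have : ∀ i ∈ range j, ∃ w : ℤ, (d : ℝ) ^ l * (1 / ((i : ℝ) + 1) ^ l) = w := by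
      intro i hi
      obtain ⟨w, hw⟩ := hd (i + 1) (by simp at *; omega)
      refine ⟨(w : ℤ) ^ l, ?_⟩
      rw [hw]
      push_cast
      rw [mul_pow]
      field_simp
    choose! w hw using this
    refine ⟨∑ i ∈ range j, w i, ?_⟩
    push_cast
    rw [mul_sum]
    exact sum_congr rfl hw
  choose! z hz using hC
  choose! w hw using hd0
  set H : ℕ → ℕ → ℝ := fun l j => ∑ i ∈ range j, 1 / ((i : ℝ) + 1) ^ l with hHdef
  have hz' : ∀ l ∈ Icc 1 a, ∀ j ∈ range (n + 1), (d : ℝ) ^ l * z l j = d ^ a * C l j := by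
    intro l hl j hj
    rw [← hz l hl j hj, ← mul_assoc, ← pow_add, Nat.add_sub_of_le (mem_Icc.mp hl).2]
  have hCM : ∑ l ∈ Icc 1 a, ∑ j ∈ range (n + 1), |C l j| ≤ 2 * M := by
    calc ∑ l ∈ Icc 1 a, ∑ j ∈ range (n + 1), |C l j| ≤
        ∑ l ∈ Icc 1 a, ∑ j ∈ range (n + 1), (|c l j| + |c l (n - j)|) := by
          refine sum_le_sum fun l _ => sum_le_sum fun j _ => ?_
          refine (abs_sub _ _).trans ?_
          rw [abs_mul, abs_pow, abs_neg, abs_one, one_pow, one_mul]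
      _ = 2 * ∑ l ∈ Icc 1 a, ∑ j ∈ range (n + 1), |c l j| := by
          rw [mul_sum]
          refine sum_congr rfl fun l _ => ?_
          rw [sum_add_distrib, hrefl fun j => |c l j|]
          ring
      _ ≤ 2 * M := by gcongr
  have hP0 : ((-∑ l ∈ Icc 1 a, ∑ j ∈ range (n + 1), z l j * w l j : ℤ) : ℝ) =
      -∑ l ∈ Icc 1 a, ∑ j ∈ range (n + 1), d ^ a * C l j * H l j := by
    push_cast
    congr 1
    refine sum_congr rfl fun l hl => sum_congr rfl fun j hj => ?_
    rw [← hw l j hj, ← hz' l hl j hj]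
    ring
  have hPl : ∀ l ∈ Icc 1 a, ((∑ j ∈ range (n + 1), (d : ℤ) ^ l * z l j : ℤ) : ℝ) = d ^ a * B l := by
    intro l hl
    push_cast
    rw [hBdef, mul_sum]
    exact sum_congr rfl fun j hj => hz' l hl j hj
  refine ⟨fun l => if l = 0 then -∑ l ∈ Icc 1 a, ∑ j ∈ range (n + 1), z l j * w l j
    else ∑ j ∈ range (n + 1), (d : ℤ) ^ l * z l j, ?_, ?_⟩
  · intro l hl
    rcases eq_or_ne l 0 with rfl | hl0
    · beta_reduce
      rw [if_pos rfl, hP0, abs_neg]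
      calc |∑ l ∈ Icc 1 a, ∑ j ∈ range (n + 1), d ^ a * C l j * H l j| ≤
          ∑ l ∈ Icc 1 a, ∑ j ∈ range (n + 1), |d ^ a * C l j * H l j| :=
            (abs_sum_le_sum_abs _ _).trans (sum_le_sum fun l _ => abs_sum_le_sum_abs _ _)
        _ ≤ ∑ l ∈ Icc 1 a, ∑ j ∈ range (n + 1), d ^ a * |C l j| * (n + 1) := by
            refine sum_le_sum fun l _ => sum_le_sum fun j hj => ?_
            rw [abs_mul, abs_mul, abs_of_nonneg (by positivity : (0 : ℝ) ≤ (d : ℝ) ^ a)]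
            refine mul_le_mul_of_nonneg_left ?_ (by positivity)
            rw [hHdef, abs_of_nonneg (sum_nonneg fun _ _ => by positivity)]
            have hj' : (j : ℝ) ≤ n := by exact_mod_cast Nat.lt_succ_iff.mp (mem_range.mp hj)
            calc ∑ i ∈ range j, 1 / ((i : ℝ) + 1) ^ l ≤ ∑ i ∈ range j, 1 :=
                  sum_le_sum fun i _ => by
                    rw [div_le_one (by positivity)]
                    exact one_le_pow₀ (by linarith [(Nat.cast_nonneg i : (0 : ℝ) ≤ i)])
              _ = j := by simp
              _ ≤ n + 1 := by linarith
        _ = d ^ a * (∑ l ∈ Icc 1 a, ∑ j ∈ range (n + 1), |C l j|) * (n + 1) := by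
            simp only [← mul_sum, ← sum_mul]
        _ ≤ d ^ a * (2 * M) * (n + 1) := by gcongr
        _ = _ := by ring
    · have hl' : l ∈ Icc 1 a := mem_Icc.mpr ⟨Nat.one_le_iff_ne_zero.mpr hl0, hl⟩
      beta_reduce
      rw [if_neg hl0, hPl l hl', abs_mul, abs_of_nonneg (by positivity : (0 : ℝ) ≤ (d : ℝ) ^ a)]
      calc (d : ℝ) ^ a * |B l| ≤ d ^ a * (2 * M) := by
            gcongr
            refine (abs_sum_le_sum_abs _ _).trans (le_trans ?_ hCM)
            exact single_le_sum (f := fun l => ∑ j ∈ range (n + 1), |C l j|)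
              (fun _ _ => sum_nonneg fun _ _ => abs_nonneg _) hl'
        _ ≤ d ^ a * (2 * M) * (n + 1) := by
            refine le_mul_of_one_le_right (by positivity) ?_
            linarith [(Nat.cast_nonneg n : (0 : ℝ) ≤ n)]
        _ = _ := by ring
  · have hS : HasSum (fun k : ℕ => ∑ l ∈ Icc 1 a, ∑ j ∈ range (n + 1), (d : ℝ) ^ a * C l j *
        (1 / ((k : ℝ) + 1 + j) ^ l - 0 ^ (l - 1) / (k + 1)))
        (∑ l ∈ Icc 1 a, ∑ j ∈ range (n + 1), (d : ℝ) ^ a * C l j *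
          ((if l = 1 then 0 else zetaVal l) - H l j)) :=
      hasSum_sum fun l hl => hasSum_sum fun j _ =>
        (hasSum_one_div_add_pow (mem_Icc.mp hl).1 j).mul_left _
    convert hS using 1
    · funext k
      have e := hf2 (k + 1) k.succ_pos
      have : ∑ l ∈ Icc 1 a, ∑ j ∈ range (n + 1), C l j * (0 ^ (l - 1) / ((k : ℝ) + 1)) = 0 := by
        have h0 : (∑ l ∈ Icc 1 a, 0 ^ (l - 1) * B l) / ((k : ℝ) + 1) = 0 := by rw [hB1, zero_div]
        rw [sum_div] at h0
        refine Eq.trans (sum_congr rfl fun l _ => ?_) h0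
        rw [← sum_mul]
        ring
      push_cast at e
      calc 2 * (d : ℝ) ^ a * f (k + 1) = d ^ a * (2 * f (k + 1) -
            ∑ l ∈ Icc 1 a, ∑ j ∈ range (n + 1), C l j * (0 ^ (l - 1) / ((k : ℝ) + 1))) := by
            rw [this]; ring
        _ = _ := by
          rw [e, ← sum_sub_distrib, mul_sum]
          refine sum_congr rfl fun l _ => ?_
          rw [← sum_sub_distrib, mul_sum]
          exact sum_congr rfl fun j _ => by ring
    · beta_reduce
      rw [if_pos rfl, hP0]
      simp only [mul_sub, sum_sub_distrib]
      rw [neg_add_eq_sub]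
      congr 1
      simp only [mul_assoc, ← mul_sum]
      rw [mul_sum]
      have : ∀ l ∈ Icc 1 a, (∑ j ∈ range (n + 1), C l j * if l = 1 then 0 else zetaVal l) =
          if l ∈ (Icc 3 a).filter Odd then B l * zetaVal l else 0 := by
        intro l hl
        rw [← sum_mul]
        have hl1 := (mem_Icc.mp hl)
        rcases eq_or_ne l 1 with rfl | h1
        · simp
        · rw [if_neg h1]
          by_cases ho : Odd l
          · rw [if_pos]
            have : l ≠ 2 := by rintro rfl; exact absurd ho (by decide)
            simp only [mem_filter, mem_Icc]
            exact ⟨⟨by omega, hl1.2⟩, ho⟩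
          · rw [if_neg (by simp [ho])]
            have := hBeven l (Nat.not_odd_iff_even.mp ho)
            simp only [hBdef] at this
            rw [this, zero_mul]
      rw [← mul_sum, sum_congr rfl this, ← sum_filter, mul_sum]
      have hfe : ((Icc 1 a).filter fun l => l ∈ (Icc 3 a).filter Odd) = (Icc 3 a).filter Odd := by
        ext l
        simp only [mem_filter, mem_Icc]
        constructor
        · exact fun h => h.2
        · exact fun h => ⟨⟨by omega, h.1.2⟩, h⟩
      rw [hfe]
      refine sum_congr rfl fun l hl => ?_
      simp only [mem_filter, mem_Icc] at hl
      have hPl' := hPl l (mem_Icc.mpr ⟨by omega, hl.1.2⟩)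
      rw [← mul_sum] at hPl'
      rw [if_neg (by omega), hPl']
      ring

end HasPartialFractions

end LinearForm

section BallRivoal

open Finset Filter Topology

/-- The well-poised rational function of Ball and Rivoal. -/
noncomputable def ballRivoal (a r n : ℕ) (t : ℝ) : ℝ :=
  (n.factorial / ∏ j ∈ range (n + 1), (t + j)) ^ (a - 2 * r) *
    ∏ b ∈ Icc 1 r, ((∏ i ∈ range n, (t - b * n + i)) / (∏ j ∈ range (n + 1), (t + j)) *
      ((∏ i ∈ range n, (t + b * n + 1 + i)) / ∏ j ∈ range (n + 1), (t + j)))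

theorem HasPartialFractions.of_simple {d n : ℕ} {g : ℝ → ℝ} {A : ℕ → ℤ} {W : ℝ}
    (hg : ∀ t : ℝ, (∀ j ∈ range (n + 1), t + j ≠ 0) →
      g t = ∑ p ∈ range (n + 1), A p / (t + p)) (hA : ∑ p ∈ range (n + 1), |(A p : ℝ)| ≤ W) :
    HasPartialFractions d n 1 W g :=
  ((sum (a := 1) (range (n + 1)) fun p hp => single (d := d) (l := 1) (by simp) hp
    ⟨A p, by simp⟩).congr fun t ht => by simpa using hg t ht).mono hA

theorem hasPartialFractions_ballRivoal {d n a r : ℕ} (hd : ∀ m ∈ Icc 1 n, m ∣ d)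
    (har : 2 * r < a) :
    HasPartialFractions d n a
      ((a * 2 ^ n) ^ (a - 2 * r) * (a * (2 ^ n * (3 * (r + 1)) ^ n)) ^ (2 * r))
      (ballRivoal a r n) := by
  have step : ∀ {l : ℕ} {M : ℝ} {f g : ℝ → ℝ} {W : ℝ}, l + 1 ≤ a → 0 ≤ W →
      HasPartialFractions d n l M f →
      (∃ A : ℕ → ℤ, (∀ t : ℝ, (∀ j ∈ range (n + 1), t + j ≠ 0) →
        g t = ∑ p ∈ range (n + 1), A p / (t + p)) ∧ ∑ p ∈ range (n + 1), |(A p : ℝ)| ≤ W) →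
      HasPartialFractions d n (l + 1) (M * (a * W)) (fun t => f t * g t) := by
    rintro l M f g W hl hW hf ⟨A, h1, h2⟩
    refine (hf.mul hd h1 h2).mono ?_
    have hl' : (l : ℝ) + 1 ≤ a := by exact_mod_cast hl
    have hM := hf.nonneg
    calc ((l : ℝ) + 1) * M * W ≤ a * M * W := by gcongr
      _ = _ := by ring
  have ha1 : (1 : ℝ) ≤ a := by exact_mod_cast (by omega : 1 ≤ a)
  have hpow : ∀ m, m + 1 ≤ a → HasPartialFractions d n (m + 1) ((a * 2 ^ n) ^ (m + 1))
      (fun t => (n.factorial / ∏ j ∈ range (n + 1), (t + j)) ^ (m + 1)) := by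
    intro m
    induction m with
    | zero =>
      intro _
      obtain ⟨A, h1, h2⟩ := exists_partialFractions_factorial n
      refine ((HasPartialFractions.of_simple h1 h2).congr fun t _ => by simp).mono ?_
      rw [zero_add, pow_one]
      exact le_mul_of_one_le_left (by positivity) ha1
    | succ m ih =>
      intro hm
      have := step hm (by positivity) (ih (by omega)) (exists_partialFractions_factorial n)
      simpa only [pow_succ] using this
  have hprod : ∀ s ≤ r, HasPartialFractions d n (a - 2 * r + 2 * s)
      ((a * 2 ^ n) ^ (a - 2 * r) * (a * (2 ^ n * (3 * (r + 1)) ^ n)) ^ (2 * s))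
      (fun t => (n.factorial / ∏ j ∈ range (n + 1), (t + j)) ^ (a - 2 * r) *
        ∏ b ∈ Icc 1 s, ((∏ i ∈ range n, (t - b * n + i)) / (∏ j ∈ range (n + 1), (t + j)) *
          ((∏ i ∈ range n, (t + b * n + 1 + i)) / ∏ j ∈ range (n + 1), (t + j)))) := by
    intro s
    induction s with
    | zero =>
      intro _
      have := hpow (a - 2 * r - 1) (by omega)
      rw [Nat.sub_add_cancel (by omega)] at this
      simpa using this
    | succ s ih =>
      intro hs
      have hb : ∀ p ∈ range (n + 1), ∀ i ∈ range n,
          |(-((s + 1 : ℕ) * n : ℤ)) - p + i| ≤ ((r : ℤ) + 1) * n := by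
        intro p hp i hi
        simp only [mem_range] at hp hi
        have h1 : ((s : ℤ) + 1) * n ≤ r * n := by gcongr; exact_mod_cast hs
        have h2 : (0 : ℤ) ≤ (s + 1) * n := by positivity
        rw [abs_le]
        push_cast
        constructor <;> nlinarith
      have hb' : ∀ p ∈ range (n + 1), ∀ i ∈ range n,
          |((s + 1 : ℕ) * n + 1 : ℤ) - p + i| ≤ ((r : ℤ) + 1) * n := by
        intro p hp i hi
        simp only [mem_range] at hp hi
        have h1 : ((s : ℤ) + 1) * n ≤ r * n := by gcongr; exact_mod_cast hs
        have h2 : (0 : ℤ) ≤ (s + 1) * n := by positivity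
        rw [abs_le]
        push_cast
        constructor <;> nlinarith
      have := step (by omega) (by positivity) (step (by omega) (by positivity) (ih (by omega))
        (exists_partialFractions_prod n r _ hb)) (exists_partialFractions_prod n r _ hb')
      refine (this.congr fun t _ => ?_).mono (le_of_eq ?_)
      · rw [prod_Icc_succ_top (by omega)]
        push_cast
        simp only [← sub_eq_add_neg, ← add_assoc]
        ring
      · rw [show 2 * (s + 1) = 2 * s + 1 + 1 by ring, pow_succ, pow_succ]
        ring
  have := hprod r le_rfl
  rwa [Nat.sub_add_cancel har.le] at this

end BallRivoal

section BallRivoalSize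

open Finset Filter Topology

variable {a r n : ℕ}

theorem prod_range_succ_neg_add (n : ℕ) (t : ℝ) :
    ∏ j ∈ range (n + 1), (-n - t + j) = (-1) ^ (n + 1) * ∏ j ∈ range (n + 1), (t + j) := by
  rw [← prod_range_reflect (fun j : ℕ => (t + j : ℝ)), ← card_range (n + 1), ← prod_const,
    card_range, ← prod_mul_distrib]
  refine prod_congr rfl fun j hj => ?_
  have : j ≤ n := by simp only [mem_range] at hj; omega
  rw [Nat.add_sub_cancel, Nat.cast_sub this]
  ring

theorem prod_range_neg_add (n : ℕ) (t c : ℝ) :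
    ∏ i ∈ range n, (-n - t + c + i) = (-1) ^ n * ∏ i ∈ range n, (t - c + 1 + i) := by
  rw [← prod_range_reflect (fun j : ℕ => (t - c + 1 + j : ℝ)), ← card_range n, ← prod_const,
    card_range, ← prod_mul_distrib]
  refine prod_congr rfl fun j hj => ?_
  have : j + 1 ≤ n := by simp only [mem_range] at hj; omega
  rw [Nat.sub_sub, add_comm 1 j, Nat.cast_sub this]
  push_cast
  ring

theorem ballRivoal_neg_sub (ha : Odd a) (har : 2 * r ≤ a) (hn : Even n) (t : ℝ) :
    ballRivoal a r n (-n - t) = -ballRivoal a r n t := by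
  have hodd : Odd (a - 2 * r) := Nat.Odd.sub_even har ha (even_two_mul r)
  have h1 : ∀ b : ℕ, ∏ i ∈ range n, (-n - t - b * n + i) = ∏ i ∈ range n, (t + b * n + 1 + i) := by
    intro b
    have := prod_range_neg_add n t (-(b * n))
    rw [hn.neg_one_pow, one_mul] at this
    simpa only [sub_neg_eq_add, ← sub_eq_add_neg] using this
  have h2 : ∀ b : ℕ, ∏ i ∈ range n, (-n - t + b * n + 1 + i) = ∏ i ∈ range n, (t - b * n + i) := by
    intro b
    have := prod_range_neg_add n t (b * n + 1)
    rw [hn.neg_one_pow, one_mul] at this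
    rw [← add_assoc] at this
    rw [this]
    exact prod_congr rfl fun i _ => by ring
  simp only [ballRivoal, prod_range_succ_neg_add, h1, h2, (hn.add_one).neg_one_pow, neg_mul,
    one_mul, div_neg, hodd.neg_pow]
  congr 2
  exact prod_congr rfl fun b _ => by ring

theorem ballRivoal_eq_zero {k : ℕ} (hk : 0 < k) (hkn : k ≤ r * n) : ballRivoal a r n k = 0 := by
  have hn : 0 < n := Nat.pos_of_ne_zero fun h => by simp [h] at hkn; omega
  have hdiv := Nat.div_add_mod (k - 1) n
  have hmod := Nat.mod_lt (k - 1) hn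
  have hb : (k - 1) / n + 1 ∈ Icc 1 r := by
    have : (k - 1) / n < r := (Nat.div_lt_iff_lt_mul hn).2 (by omega)
    exact mem_Icc.2 ⟨Nat.le_add_left _ _, this⟩
  rw [ballRivoal, prod_eq_zero hb, mul_zero]
  rw [prod_eq_zero (i := n - 1 - (k - 1) % n) (mem_range.2 (by omega)), zero_div, zero_mul]
  have e : k + (n - 1 - (k - 1) % n) = ((k - 1) / n + 1) * n := by
    rw [add_mul, mul_comm ((k - 1) / n) n]; omega
  have e' : (k : ℝ) + (n - 1 - (k - 1) % n : ℕ) = ((k - 1) / n + 1 : ℕ) * n := by exact_mod_cast e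
  linarith

theorem prod_add_pos {t : ℝ} (ht : 0 < t) (m : ℕ) : 0 < ∏ j ∈ range m, (t + j) :=
  prod_pos fun _ _ => by positivity

theorem sub_mul_pos_of_mem {b : ℕ} (hb : b ∈ Icc 1 r) {t : ℝ} (ht : r * n < t) :
    0 < t - b * n := by
  have : (b : ℝ) * n ≤ r * n := by
    gcongr
    exact_mod_cast (mem_Icc.1 hb).2
  linarith

theorem ballRivoal_pos {t : ℝ} (ht : r * n < t) : 0 < ballRivoal a r n t := by
  have h0 : 0 < t := lt_of_le_of_lt (by positivity) ht
  have hD := prod_add_pos h0 (n + 1)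
  refine mul_pos (pow_pos (div_pos (by positivity) hD) _) (prod_pos fun b hb => ?_)
  have hQ := prod_add_pos (sub_mul_pos_of_mem hb ht) n
  have hQ' : 0 < ∏ i ∈ range n, (t + b * n + 1 + i) := prod_add_pos (by positivity) n
  positivity

/-- Comparing all factors of two products of Ball–Rivoal shape. -/
theorem pow_mul_prod_mul_le {x x' E : ℝ} {y y' z z' : ℕ → ℝ} (har : 2 * r ≤ a)
    (hx : 0 ≤ x) (hx' : x ≤ E * x') (hy : ∀ b ∈ Icc 1 r, 0 ≤ y b ∧ y b ≤ E * y' b)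
    (hz : ∀ b ∈ Icc 1 r, 0 ≤ z b ∧ z b ≤ E * z' b) :
    x ^ (a - 2 * r) * ∏ b ∈ Icc 1 r, (y b * z b) ≤
      E ^ a * (x' ^ (a - 2 * r) * ∏ b ∈ Icc 1 r, (y' b * z' b)) := by
  calc x ^ (a - 2 * r) * ∏ b ∈ Icc 1 r, (y b * z b)
      ≤ (E * x') ^ (a - 2 * r) * ∏ b ∈ Icc 1 r, ((E * y' b) * (E * z' b)) := by
        have hEx : 0 ≤ E * x' := hx.trans hx'
        refine mul_le_mul (pow_le_pow_left₀ hx hx' _) (prod_le_prod (fun b hb => ?_) fun b hb => ?_)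
          (prod_nonneg fun b hb => ?_) (by positivity)
        · exact mul_nonneg (hy b hb).1 (hz b hb).1
        · exact mul_le_mul (hy b hb).2 (hz b hb).2 (hz b hb).1 ((hy b hb).1.trans (hy b hb).2)
        · exact mul_nonneg (hy b hb).1 (hz b hb).1
    _ = _ := by
        have : E ^ a = E ^ (a - 2 * r) * ∏ b ∈ Icc 1 r, (E * E) := by
          rw [prod_const, Nat.card_Icc, Nat.add_sub_cancel, ← pow_two, ← pow_mul, ← pow_add,
            Nat.sub_add_cancel har]
        rw [this, mul_pow]
        simp only [prod_mul_distrib]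
        ring

theorem le_ballRivoal_first (har : 2 * r ≤ a) (hn : 0 < n) :
    (1 / (3 * (r + 2))) ^ (n * a) ≤ ((r + 2) * n) ^ a * ballRivoal a r n (r * n + 1) := by
  have hn1 : (1 : ℝ) ≤ n := by exact_mod_cast hn
  set t : ℝ := r * n + 1 with ht
  have ht0 : 0 < t := by positivity
  have hD := prod_add_pos ht0 (n + 1)
  have hDle : ∏ j ∈ range (n + 1), (t + j) ≤ ((r + 2) * n) ^ (n + 1) := by
    calc _ ≤ ∏ j ∈ range (n + 1), (((r + 2) * n : ℝ)) := by
          refine prod_le_prod (fun _ _ => by positivity) fun j hj => ?_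
          have : (j : ℝ) ≤ n := by
            simp only [mem_range] at hj
            exact_mod_cast (by omega : j ≤ n)
          rw [ht]; linarith
      _ = _ := by simp
  set L : ℝ := (1 / (3 * (r + 2))) ^ n
  have hL0 : 0 ≤ L := by positivity
  have hx : L ≤ ((r + 2) * n) * (n.factorial / ∏ j ∈ range (n + 1), (t + j)) := by
    have h3 := pow_self_le_three_pow_mul_factorial n
    rw [mul_div_assoc', le_div_iff₀ hD]
    calc L * _ ≤ L * ((r + 2) * n) ^ (n + 1) := by gcongr
      _ = ((r + 2) * n) * (n ^ n / 3 ^ n) := by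
        simp only [L]
        rw [pow_succ, mul_pow, div_pow, mul_pow, one_pow]
        field_simp
      _ ≤ _ := by
        gcongr
        rw [div_le_iff₀ (by positivity)]
        linarith
  have hfac : ∀ u : ℝ, 1 ≤ u → (n.factorial : ℝ) ≤ ∏ i ∈ range n, (u + i) := by
    intro u hu
    rw [← prod_range_add_one_eq_factorial]
    push_cast
    exact prod_le_prod (fun _ _ => by positivity) fun i _ => by linarith
  have key : ∀ u : ℝ, 1 ≤ u →
      0 ≤ L ∧ L ≤ ((r + 2) * n) * ((∏ i ∈ range n, (u + i)) / ∏ j ∈ range (n + 1), (t + j)) := by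
    intro u hu
    refine ⟨hL0, hx.trans ?_⟩
    gcongr
    exact hfac u hu
  have := pow_mul_prod_mul_le har (E := (r + 2) * n) hL0 hx
    (y := fun _ => L) (z := fun _ => L)
    (y' := fun b => (∏ i ∈ range n, (t - b * n + i)) / ∏ j ∈ range (n + 1), (t + j))
    (z' := fun b => (∏ i ∈ range n, (t + b * n + 1 + i)) / ∏ j ∈ range (n + 1), (t + j))
    (fun b hb => key _ (by
      have : (b : ℝ) * n ≤ r * n := by gcongr; exact_mod_cast (mem_Icc.1 hb).2
      rw [ht]; linarith))
    (fun b hb => key _ (by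
      have : (0 : ℝ) ≤ b * n := by positivity
      linarith))
  refine le_trans (le_of_eq ?_) this
  rw [prod_const, Nat.card_Icc, Nat.add_sub_cancel, ← pow_two, ← pow_mul (_ ^ n : ℝ), ← pow_add,
    Nat.sub_add_cancel har, ← pow_mul]

theorem ballRivoal_le_succ (har : 2 * r ≤ a) {t : ℝ} (ht : r * n + 1 ≤ t) :
    ballRivoal a r n t ≤
      ((t + n + r + 1) ^ (r + 1)) ^ a * ballRivoal a r (n + 1) (t + r) := by
  have hrn : (0 : ℝ) ≤ r * n := by positivity
  have h0 : 0 < t := by linarith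
  have hD := prod_add_pos h0 (n + 1)
  have hD' := prod_add_pos (by positivity : 0 < t + r) (n + 1 + 1)
  set E : ℝ := (t + n + r + 1) ^ (r + 1) with hE
  have hE0 : 0 ≤ E := by positivity
  have hDD : ∏ j ∈ range (n + 1 + 1), (t + r + j) ≤ E * ∏ j ∈ range (n + 1), (t + j) := by
    have e1 : (∏ j ∈ range r, (t + j)) * ∏ j ∈ range (n + 1 + 1), (t + r + j) =
        (∏ j ∈ range (n + 1), (t + j)) * ∏ j ∈ range (r + 1), (t + (n + 1 + j : ℕ)) := by
      have h1 := prod_range_add (fun j : ℕ => t + (j : ℝ)) r (n + 1 + 1)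
      have h2 := prod_range_add (fun j : ℕ => t + (j : ℝ)) (n + 1) (r + 1)
      rw [← h2, show n + 1 + (r + 1) = r + (n + 1 + 1) by ring, h1]
      push_cast
      simp only [add_assoc]
    have h1 : 1 ≤ ∏ j ∈ range r, (t + j) := by
      calc (1 : ℝ) = ∏ j ∈ range r, (1 : ℝ) := by simp
        _ ≤ _ := prod_le_prod (fun _ _ => zero_le_one) fun j _ => by
          have : (0 : ℝ) ≤ j := by positivity
          linarith
    have h2 : ∏ j ∈ range (r + 1), (t + (n + 1 + j : ℕ)) ≤ E := by
      calc _ ≤ ∏ j ∈ range (r + 1), (t + n + r + 1) := by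
            refine prod_le_prod (fun _ _ => by positivity) fun j hj => ?_
            have : (j : ℝ) ≤ r := by
              simp only [mem_range] at hj
              exact_mod_cast (by omega : j ≤ r)
            push_cast
            linarith
        _ = _ := by simp [hE]
    calc _ ≤ (∏ j ∈ range r, (t + j)) * ∏ j ∈ range (n + 1 + 1), (t + r + j) :=
          le_mul_of_one_le_left hD'.le h1
      _ = _ := e1
      _ ≤ _ := by rw [mul_comm]; gcongr
  have key : ∀ N N' : ℝ, 0 ≤ N → N ≤ N' →
      0 ≤ N / ∏ j ∈ range (n + 1), (t + j) ∧ N / ∏ j ∈ range (n + 1), (t + j) ≤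
      E * (N' / ∏ j ∈ range (n + 1 + 1), (t + r + j)) := by
    intro N N' hN hNN
    refine ⟨by positivity, ?_⟩
    rw [mul_div_assoc', div_le_div_iff₀ hD hD']
    calc N * _ ≤ N' * (E * ∏ j ∈ range (n + 1), (t + j)) := by gcongr; exact hN.trans hNN
      _ = _ := by ring
  have hx := key n.factorial (n + 1).factorial (by positivity)
    (by exact_mod_cast Nat.factorial_le (Nat.le_succ n))
  refine pow_mul_prod_mul_le har hx.1 hx.2 (fun b hb => key _ _ ?_ ?_)
    (fun b hb => key _ _ ?_ ?_)
  · exact (prod_add_pos (sub_mul_pos_of_mem hb (by linarith)) n).le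
  · have hb' : (b : ℝ) ≤ r := by exact_mod_cast (mem_Icc.1 hb).2
    have hbn : (b : ℝ) * n ≤ r * n := by gcongr
    have hpos := sub_mul_pos_of_mem (n := n) hb (t := t) (by linarith)
    rw [prod_range_succ]
    push_cast
    refine (prod_le_prod (fun i _ => by positivity) fun i _ => ?_).trans
      (le_mul_of_one_le_right (prod_nonneg fun i _ => ?_) ?_)
    · linarith
    · have : (0 : ℝ) ≤ i := by positivity
      linarith
    · have : (0 : ℝ) ≤ n := by positivity
      linarith
  · exact (prod_add_pos (by positivity) n).le
  · rw [prod_range_succ]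
    push_cast
    have hb0 : (0 : ℝ) ≤ b := by positivity
    have hr0 : (0 : ℝ) ≤ r := by positivity
    refine (prod_le_prod (fun i _ => by positivity) fun i _ => ?_).trans
      (le_mul_of_one_le_right (prod_nonneg fun i _ => ?_) ?_)
    · linarith
    · positivity
    · have : (0 : ℝ) ≤ n := by positivity
      have : (0 : ℝ) ≤ b * (n + 1) := by positivity
      linarith

theorem ballRivoal_le (hr : 0 < r) {K : ℕ} (hK : r ≤ K) {k : ℕ} (hk : 0 < k)
    (hkK : K * n < k) :
    ballRivoal a r n k ≤ (3 ^ r / K ^ (a - 2 * r)) ^ n * (1 / (k : ℝ) ^ 2) := by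
  have hk1 : (1 : ℝ) ≤ k := by exact_mod_cast hk
  have hk0 : (0 : ℝ) < k := by positivity
  have hKn : (K : ℝ) * n ≤ k := by exact_mod_cast hkK.le
  have hK0 : (0 : ℝ) < K := by exact_mod_cast (by omega : 0 < K)
  have hrn : (r : ℝ) * n < k := by
    exact_mod_cast lt_of_le_of_lt (Nat.mul_le_mul_right n hK) hkK
  have hnk : (n : ℝ) ≤ k := by
    have : (1 : ℝ) ≤ r := by exact_mod_cast hr
    nlinarith
  have hD := prod_add_pos hk0 (n + 1)
  have hDle : (k : ℝ) ^ (n + 1) ≤ ∏ j ∈ range (n + 1), ((k : ℝ) + j) := by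
    calc _ = ∏ j ∈ range (n + 1), (k : ℝ) := by simp
      _ ≤ _ := prod_le_prod (fun _ _ => by positivity) fun j _ => by
        have : (0 : ℝ) ≤ j := by positivity
        linarith
  have key : ∀ N C : ℝ, 0 ≤ C → N ≤ C * k ^ n →
      N / ∏ j ∈ range (n + 1), ((k : ℝ) + j) ≤ C * (1 / k) := by
    intro N C hC hN
    rw [div_le_iff₀ hD]
    calc N ≤ C * k ^ n := hN
      _ = C * (1 / k) * k ^ (n + 1) := by rw [pow_succ]; field_simp
      _ ≤ _ := by gcongr
  have hx : n.factorial / ∏ j ∈ range (n + 1), ((k : ℝ) + j) ≤ (1 / K) ^ n * (1 / k) := by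
    refine key _ _ (by positivity) ?_
    calc (n.factorial : ℝ) ≤ (n : ℝ) ^ n := by exact_mod_cast Nat.factorial_le_pow n
      _ ≤ (1 / K * k) ^ n := by
        gcongr
        rw [one_div, inv_mul_eq_div, le_div_iff₀ hK0]
        linarith
      _ = _ := mul_pow _ _ _
  have hy : ∀ b ∈ Icc 1 r, 0 ≤ (∏ i ∈ range n, ((k : ℝ) - b * n + i)) /
      (∏ j ∈ range (n + 1), ((k : ℝ) + j)) ∧ (∏ i ∈ range n, ((k : ℝ) - b * n + i)) /
      (∏ j ∈ range (n + 1), ((k : ℝ) + j)) ≤ 1 / k := by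
    intro b hb
    have h1 : (1 : ℝ) ≤ b := by exact_mod_cast (mem_Icc.1 hb).1
    have hpos := sub_mul_pos_of_mem hb hrn
    refine ⟨div_nonneg (prod_add_pos hpos n).le hD.le, ?_⟩
    have := key (∏ i ∈ range n, ((k : ℝ) - b * n + i)) 1 zero_le_one ?_
    · simpa using this
    rw [one_mul]
    calc _ ≤ ∏ i ∈ range n, (k : ℝ) := prod_le_prod (fun _ _ => by positivity) fun i hi => by
          have : (i : ℝ) ≤ n := by
            simp only [mem_range] at hi
            exact_mod_cast hi.le
          nlinarith
      _ = _ := by simp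
  have hz : ∀ b ∈ Icc 1 r, 0 ≤ (∏ i ∈ range n, ((k : ℝ) + b * n + 1 + i)) /
      (∏ j ∈ range (n + 1), ((k : ℝ) + j)) ∧ (∏ i ∈ range n, ((k : ℝ) + b * n + 1 + i)) /
      (∏ j ∈ range (n + 1), ((k : ℝ) + j)) ≤ 3 ^ n * (1 / k) := by
    intro b hb
    have hb' : (b : ℝ) * n ≤ r * n := by gcongr; exact_mod_cast (mem_Icc.1 hb).2
    refine ⟨by positivity, key _ _ (by positivity) ?_⟩
    calc _ ≤ ∏ i ∈ range n, (3 * k : ℝ) := prod_le_prod (fun _ _ => by positivity) fun i hi => by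
          have : (i : ℝ) + 1 ≤ n := by
            simp only [mem_range] at hi
            exact_mod_cast hi
          linarith
      _ = _ := by simp [mul_pow]
  have hk1' : 1 / (k : ℝ) ≤ 1 := by rw [div_le_one hk0]; exact hk1
  calc ballRivoal a r n k ≤ ((1 / K) ^ n * (1 / k)) ^ (a - 2 * r) *
        ∏ b ∈ Icc 1 r, (1 / k * (3 ^ n * (1 / k)) : ℝ) := by
        unfold ballRivoal
        refine mul_le_mul (pow_le_pow_left₀ (by positivity) hx _)
          (prod_le_prod (fun b hb => ?_) fun b hb => ?_)
          (prod_nonneg fun b hb => ?_) (by positivity)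
        · exact mul_nonneg (hy b hb).1 (hz b hb).1
        · exact mul_le_mul (hy b hb).2 (hz b hb).2 (hz b hb).1 (by positivity)
        · exact mul_nonneg (hy b hb).1 (hz b hb).1
    _ = (3 ^ r / K ^ (a - 2 * r)) ^ n * ((1 / k) ^ (a - 2 * r) * (1 / k) ^ (2 * r)) := by
        rw [prod_const, Nat.card_Icc, Nat.add_sub_cancel]
        simp only [div_pow, mul_pow, one_pow, ← pow_mul]
        rw [mul_comm r n, mul_comm n (a - 2 * r)]
        ring
    _ ≤ (3 ^ r / K ^ (a - 2 * r)) ^ n * (1 * (1 / k) ^ 2) := by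
        gcongr ?_ * (?_ * ?_)
        · exact pow_le_one₀ (by positivity) hk1'
        · exact pow_le_pow_of_le_one (by positivity) hk1' (by omega)
    _ = _ := by rw [one_mul, one_div_pow]

end BallRivoalSize

section BallRivoalSum

open Finset Filter Topology

variable {a r n : ℕ}

theorem ballRivoal_nat_nonneg (k : ℕ) : 0 ≤ ballRivoal a r n (k + 1) := by
  by_cases h : k + 1 ≤ r * n
  · exact_mod_cast (ballRivoal_eq_zero (a := a) k.succ_pos h).ge
  · refine (ballRivoal_pos ?_).le
    exact_mod_cast not_le.1 h

theorem ballRivoal_nat_le (hr : 0 < r) (k : ℕ) :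
    ballRivoal a r n (k + 1) ≤
      (3 ^ r / r ^ (a - 2 * r)) ^ n * (1 / ((k : ℝ) + 1) ^ 2) := by
  by_cases h : k + 1 ≤ r * n
  · have := ballRivoal_eq_zero (a := a) k.succ_pos h
    push_cast at this
    rw [this]
    positivity
  · have := ballRivoal_le (a := a) hr le_rfl k.succ_pos (not_le.1 h)
    push_cast at this
    exact this

theorem summable_one_div_add_one_sq : Summable fun k : ℕ => 1 / ((k : ℝ) + 1) ^ 2 := by
  have := (summable_nat_add_iff 1).2 (Real.summable_one_div_nat_pow.2 one_lt_two)
  simpa using this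

theorem summable_ballRivoal (hr : 0 < r) :
    Summable fun k : ℕ => ballRivoal a r n (k + 1) :=
  .of_nonneg_of_le ballRivoal_nat_nonneg (ballRivoal_nat_le hr)
    (summable_one_div_add_one_sq.mul_left _)

theorem tendsto_mul_ballRivoal (hr : 0 < r) :
    Tendsto (fun k : ℕ => (k : ℝ) * ballRivoal a r n k) atTop (𝓝 0) := by
  rw [← tendsto_add_atTop_iff_nat 1]
  have h : Tendsto (fun k : ℕ => (3 ^ r / (r : ℝ) ^ (a - 2 * r)) ^ n * (1 / ((k : ℝ) + 1)))
      atTop (𝓝 0) := by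
    simpa using tendsto_one_div_add_atTop_nhds_zero_nat.const_mul
      ((3 ^ r / (r : ℝ) ^ (a - 2 * r)) ^ n)
  refine squeeze_zero (fun k => ?_) (fun k => ?_) h
  · have := ballRivoal_nat_nonneg (a := a) (r := r) (n := n) k
    push_cast
    positivity
  · have := ballRivoal_nat_le (a := a) (n := n) hr k
    push_cast
    calc ((k : ℝ) + 1) * ballRivoal a r n (k + 1) ≤
          (k + 1) * ((3 ^ r / (r : ℝ) ^ (a - 2 * r)) ^ n * (1 / ((k : ℝ) + 1) ^ 2)) := by gcongr
      _ = (3 ^ r / (r : ℝ) ^ (a - 2 * r)) ^ n * (((k : ℝ) + 1) / (k + 1) ^ 2) := by ring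
      _ = _ := by rw [pow_two ((k : ℝ) + 1), div_mul_cancel_left₀ (by positivity), one_div]

/-- The series attached to `ballRivoal`. -/
noncomputable def ballRivoalSum (a r n : ℕ) : ℝ := ∑' k : ℕ, ballRivoal a r n (k + 1)

theorem ballRivoal_le_sum (hr : 0 < r) (k : ℕ) :
    ballRivoal a r n (k + 1) ≤ ballRivoalSum a r n :=
  (summable_ballRivoal hr).le_tsum k fun j _ => ballRivoal_nat_nonneg j

theorem ballRivoalSum_pos (hr : 0 < r) : 0 < ballRivoalSum a r n := by
  have h : 0 < ballRivoal a r n ((r * n : ℕ) + 1) := ballRivoal_pos (by push_cast; linarith)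
  exact h.trans_le (ballRivoal_le_sum hr _)

theorem ballRivoalSum_le (hr : 0 < r) :
    ballRivoalSum a r n ≤
      (3 ^ r / r ^ (a - 2 * r)) ^ n * ∑' k : ℕ, 1 / ((k : ℝ) + 1) ^ 2 := by
  rw [← tsum_mul_left]
  exact (summable_ballRivoal hr).tsum_le_tsum (ballRivoal_nat_le hr)
    (summable_one_div_add_one_sq.mul_left _)

theorem exists_ballRivoalSum_le_succ (hr : 0 < r) (har : 2 * r < a) :
    ∃ C : ℝ, ∃ N : ℕ, 0 < C ∧
      ∀ n, 0 < n → ballRivoalSum a r n ≤ C * n ^ N * ballRivoalSum a r (n + 1) := by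
  set K : ℕ := 3 ^ r * (3 * (r + 2)) ^ a with hK
  set Z : ℝ := ∑' k : ℕ, 1 / ((k : ℝ) + 1) ^ 2
  have hZ : 0 ≤ Z := tsum_nonneg fun _ => by positivity
  have hrK : r + 1 ≤ K := by
    have h1 : 3 * (r + 2) ≤ (3 * (r + 2)) ^ a := Nat.le_self_pow (by omega) _
    have h2 : 1 * (3 * (r + 2)) ^ a ≤ K := Nat.mul_le_mul_right _ (Nat.one_le_pow _ _ (by norm_num))
    omega
  have hK0 : (0 : ℝ) < K := by exact_mod_cast (by omega : 0 < K)
  refine ⟨(K + Z * (r + 2) ^ a) * (K + r + 2) ^ ((r + 1) * a), a + (r + 1) * a, by positivity,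
    fun n hn => ?_⟩
  have hn1 : (1 : ℝ) ≤ n := by exact_mod_cast hn
  set S := ballRivoalSum a r (n + 1)
  have hS : 0 < S := ballRivoalSum_pos hr
  set T : ℝ := ((K + r + 2) * n) ^ ((r + 1) * a) with hT
  have hT0 : 0 ≤ T := by positivity
  have hhead : ∀ k : ℕ, k < K * n → ballRivoal a r n (k + 1) ≤ T * S := by
    intro k hk
    by_cases h : k + 1 ≤ r * n
    · have := ballRivoal_eq_zero (a := a) k.succ_pos h
      push_cast at this
      rw [this]
      positivity
    · have h1 : (r : ℝ) * n + 1 ≤ k + 1 := by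
        have : r * n ≤ k := by omega
        exact_mod_cast Nat.succ_le_succ this
      have hkK : (k : ℝ) + 1 ≤ K * n := by exact_mod_cast hk
      refine (ballRivoal_le_succ har.le h1).trans ?_
      have h2 : ballRivoal a r (n + 1) ((k : ℝ) + 1 + r) ≤ S := by
        have := ballRivoal_le_sum (a := a) (n := n + 1) hr (k + r)
        convert this using 2
        push_cast
        ring
      have h3 : (0 : ℝ) ≤ ballRivoal a r (n + 1) ((k : ℝ) + 1 + r) := by
        have := ballRivoal_nat_nonneg (a := a) (r := r) (n := n + 1) (k + r)
        convert this using 2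
        push_cast
        ring
      rw [hT, ← pow_mul]
      gcongr
      have : (r : ℝ) ≤ r * n := le_mul_of_one_le_right (by positivity) hn1
      linarith
  have hfirst : (3 ^ r / (K : ℝ) ^ (a - 2 * r)) ^ n ≤ ((r + 2) * n) ^ a * (T * S) := by
    have h1 : ballRivoal a r n (r * n + 1) ≤ T * S := by
      have := hhead (r * n) (by nlinarith)
      push_cast at this
      exact this
    calc (3 ^ r / (K : ℝ) ^ (a - 2 * r)) ^ n ≤ (3 ^ r / (K : ℝ) ^ 1) ^ n := by
          gcongr
          · exact_mod_cast (by omega : 1 ≤ K)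
          · omega
      _ = (1 / (3 * (r + 2))) ^ (n * a) := by
          rw [mul_comm n a, pow_mul, hK]
          push_cast
          congr 1
          rw [div_pow, one_pow]
          field_simp
      _ ≤ _ := le_ballRivoal_first har.le hn
      _ ≤ _ := by gcongr
  have hterm : ∀ k : ℕ, ballRivoal a r n (k + 1) ≤
      (if k ∈ range (K * n) then T * S else 0) +
        ((r + 2) * n) ^ a * (T * S) * (1 / ((k : ℝ) + 1) ^ 2) := by
    intro k
    split_ifs with h
    · refine (hhead k (mem_range.1 h)).trans (le_add_of_nonneg_right (by positivity))
    · have := ballRivoal_le (a := a) hr (by omega : r ≤ K) k.succ_pos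
        (by simp only [mem_range] at h; omega : K * n < k + 1)
      push_cast at this
      rw [zero_add]
      refine this.trans ?_
      gcongr
  have hs1 : HasSum (fun k : ℕ => if k ∈ range (K * n) then T * S else 0)
      (∑ k ∈ range (K * n), T * S) := by
    have : HasSum (fun k : ℕ => if k ∈ range (K * n) then T * S else 0)
        (∑ k ∈ range (K * n), if k ∈ range (K * n) then T * S else 0) :=
      hasSum_sum_of_ne_finset_zero fun k hk => by simp [hk]
    convert this using 1
    exact sum_congr rfl fun k hk => by simp [hk]
  have hs2 := (summable_one_div_add_one_sq.hasSum).mul_left (((r + 2) * n : ℝ) ^ a * (T * S))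
  have hle := hasSum_le hterm (summable_ballRivoal (a := a) (n := n) hr).hasSum (hs1.add hs2)
  calc ballRivoalSum a r n ≤ _ := hle
    _ = (K * n + Z * (r + 2) ^ a * n ^ a) * T * S := by
        simp only [sum_const, card_range, nsmul_eq_mul, mul_pow, Z]
        push_cast
        ring
    _ ≤ (K * n ^ a + Z * (r + 2) ^ a * n ^ a) * T * S := by
        gcongr
        exact le_self_pow₀ hn1 (by omega)
    _ = _ := by
        rw [hT, mul_pow, pow_add]
        ring

end BallRivoalSum

section Asymptotics

open Filter Topology Real

theorem tendsto_log_natCast_atTop : Tendsto (fun s : ℕ => log s) atTop atTop :=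
  tendsto_log_atTop.comp tendsto_natCast_atTop_atTop

theorem tendsto_floor_div_log_sq_div :
    Tendsto (fun s : ℕ => (⌊(s : ℝ) / log s ^ 2⌋₊ : ℝ) / s * log s) atTop (𝓝 0) := by
  refine squeeze_zero' (Eventually.of_forall fun s => ?_) ?_
    (tendsto_inv_atTop_zero.comp tendsto_log_natCast_atTop)
  · exact mul_nonneg (by positivity) (log_natCast_nonneg s)
  · filter_upwards [tendsto_log_natCast_atTop.eventually_gt_atTop 0, eventually_gt_atTop 0]
      with s hL hs
    have hs' : (0 : ℝ) < s := by exact_mod_cast hs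
    calc (⌊(s : ℝ) / log s ^ 2⌋₊ : ℝ) / s * log s ≤ (s : ℝ) / log s ^ 2 / s * log s := by
          gcongr
          exact Nat.floor_le (by positivity)
      _ = _ := by simp only [Function.comp]; field_simp

theorem tendsto_floor_div_log_sq_div' :
    Tendsto (fun s : ℕ => (⌊(s : ℝ) / log s ^ 2⌋₊ : ℝ) / s) atTop (𝓝 0) := by
  have h := tendsto_floor_div_log_sq_div.mul
    (tendsto_inv_atTop_zero.comp tendsto_log_natCast_atTop)
  rw [mul_zero] at h
  refine h.congr' ?_
  filter_upwards [tendsto_log_natCast_atTop.eventually_gt_atTop 0] with s hL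
  simp only [Function.comp]
  field_simp

theorem tendsto_log_log_div_log :
    Tendsto (fun s : ℕ => log (log s) / log s) atTop (𝓝 0) :=
  isLittleO_log_id_atTop.tendsto_div_nhds_zero.comp tendsto_log_natCast_atTop

theorem eventually_div_log_sq_bounds :
    ∀ᶠ s : ℕ in atTop, 1 < log s ∧ 2 ≤ (s : ℝ) / log s ^ 2 := by
  have h := (isLittleO_pow_log_id_atTop (n := 2)).bound (c := 1 / 2) (by norm_num)
  filter_upwards [tendsto_natCast_atTop_atTop.eventually h,
    tendsto_log_natCast_atTop.eventually_gt_atTop 1] with s h1 hL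
  refine ⟨hL, ?_⟩
  rw [le_div_iff₀ (by positivity)]
  simp only [norm_pow, norm_eq_abs, sq_abs, id, Nat.abs_cast] at h1
  linarith

theorem tendsto_log_floor_div_log_sq :
    Tendsto (fun s : ℕ => log (⌊(s : ℝ) / log s ^ 2⌋₊ : ℝ) / log s) atTop (𝓝 1) := by
  have hlow : Tendsto (fun s : ℕ => 1 - 2 * (log (log s) / log s) - log 2 * (log s)⁻¹) atTop
      (𝓝 1) := by
    simpa using (tendsto_log_log_div_log.const_mul 2).const_sub 1 |>.sub
      ((tendsto_inv_atTop_zero.comp tendsto_log_natCast_atTop).const_mul (log 2))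
  refine tendsto_of_tendsto_of_tendsto_of_le_of_le' hlow tendsto_const_nhds ?_ ?_
  · filter_upwards [eventually_div_log_sq_bounds, eventually_gt_atTop 0] with s ⟨hL, h2⟩ hs
    have hs' : (0 : ℝ) < s := by exact_mod_cast hs
    have hfl := Nat.sub_one_lt_floor ((s : ℝ) / log s ^ 2)
    have h1 : (s : ℝ) / log s ^ 2 / 2 ≤ ⌊(s : ℝ) / log s ^ 2⌋₊ := by linarith
    have h3 := log_le_log (by positivity) h1
    rw [log_div (by positivity) (by norm_num), log_div (by positivity) (by positivity), log_pow]
      at h3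
    rw [le_div_iff₀ (by positivity)]
    refine le_trans (le_of_eq ?_) h3
    push_cast
    field_simp
  · filter_upwards [eventually_div_log_sq_bounds, eventually_gt_atTop 0] with s ⟨hL, h2⟩ hs
    have hs' : (0 : ℝ) < s := by exact_mod_cast hs
    have hfl := Nat.sub_one_lt_floor ((s : ℝ) / log s ^ 2)
    rw [div_le_one (by positivity)]
    refine log_le_log (by linarith) ((Nat.floor_le (by positivity)).trans ?_)
    exact div_le_self hs'.le (one_le_pow₀ hL.le)

theorem eventually_exists_parameter {ε : ℝ} (hε : 0 < ε) (hε1 : ε ≤ 1) : ∀ᶠ s : ℕ in atTop, ∃ r : ℕ,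
    0 < r ∧ 2 * r < s ∧ (1 - ε) / (1 + log 2) * log s *
      (s + 1 + s * log 2 + 2 * r * log (3 * (r + 1))) ≤
      (s - 2 * r) * log r - r * log 3 - s - 1 := by
  have hinv := tendsto_inv_atTop_zero.comp tendsto_log_natCast_atTop
  have hs0 : Tendsto (fun s : ℕ => ((s : ℝ))⁻¹) atTop (𝓝 0) :=
    tendsto_inv_atTop_zero.comp tendsto_natCast_atTop_atTop
  have hr := tendsto_floor_div_log_sq_div'
  have hrl := tendsto_floor_div_log_sq_div
  have hA := ((((hr.const_mul 2).const_sub 1).mul tendsto_log_floor_div_log_sq).sub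
    ((hr.mul_const (log 3)).mul hinv)).sub (hinv.add (hs0.mul hinv))
  have hB := ((hs0.const_add (1 + log 2)).add
    ((hrl.add (hr.mul_const (log 3))).const_mul 2)).const_mul ((1 - ε) / (1 + log 2))
  have hlog2 : 0 < 1 + log 2 := by have := log_pos one_lt_two; linarith
  have hAB := hA.sub hB
  simp only [mul_zero, zero_mul, sub_zero, add_zero, mul_one, div_mul_cancel₀ _ hlog2.ne',
    sub_sub_cancel] at hAB
  filter_upwards [hAB.eventually_const_lt hε, eventually_div_log_sq_bounds,
    hr.eventually_lt_const (show (0 : ℝ) < 1 / 2 by norm_num), eventually_gt_atTop 0]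
    with s h1 ⟨hL, h2⟩ h3 hs
  set r := ⌊(s : ℝ) / log s ^ 2⌋₊
  have hs' : (0 : ℝ) < s := by exact_mod_cast hs
  have hr0 : 0 < r := Nat.floor_pos.2 (by linarith)
  have hrs : 2 * r < s := by
    rw [div_lt_iff₀ hs'] at h3
    exact_mod_cast (by linarith : 2 * (r : ℝ) < s)
  refine ⟨r, hr0, hrs, ?_⟩
  have hL0 : 0 < log s := by linarith
  have hlog : log (3 * (r + 1)) ≤ log s + log 3 := by
    rw [← log_mul hs'.ne' (by norm_num)]
    refine log_le_log (by positivity) ?_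
    have : (r : ℝ) + 1 ≤ s := by exact_mod_cast (by omega : r + 1 ≤ s)
    linarith
  have hc : 0 ≤ (1 - ε) / (1 + log 2) := div_nonneg (by linarith) hlog2.le
  simp only [Function.comp] at h1
  calc _ ≤ (1 - ε) / (1 + log 2) * log s *
        (s + 1 + s * log 2 + 2 * r * (log s + log 3)) := by gcongr
    _ = s * log s * ((1 - ε) / (1 + log 2) * (1 + log 2 + (s : ℝ)⁻¹ +
        2 * ((r : ℝ) / s * log s + (r : ℝ) / s * log 3))) := by field_simp; ring
    _ ≤ s * log s * ((1 - 2 * ((r : ℝ) / s)) * (log r / log s) -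
        (r : ℝ) / s * log 3 * (log s)⁻¹ - ((log s)⁻¹ + (s : ℝ)⁻¹ * (log s)⁻¹)) := by
        gcongr
        exact (sub_pos.1 h1).le
    _ = _ := by field_simp; ring

end Asymptotics

section LinearForms

open Finset Filter Topology Real

theorem exists_linearForm_ballRivoal {s r n : ℕ} (hs : Odd s) (hr : 0 < r) (hrs : 2 * r < s)
    (hn : Even n) :
    ∃ P : ℕ → ℤ,
      (∀ l ≤ s, |(P l : ℝ)| ≤ 2 * (Nat.lcmUpto n : ℝ) ^ s *
        ((s * 2 ^ n) ^ (s - 2 * r) * (s * (2 ^ n * (3 * (r + 1)) ^ n)) ^ (2 * r)) * (n + 1)) ∧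
      P 0 + ∑ l ∈ Icc 3 s with Odd l, P l * zetaVal l =
        2 * (Nat.lcmUpto n : ℝ) ^ s * ballRivoalSum s r n := by
  have hd : ∀ m ∈ Icc 1 n, m ∣ Nat.lcmUpto n := fun m hm => dvd_lcm (f := id) hm
  obtain ⟨P, h1, h2⟩ := (hasPartialFractions_ballRivoal hd hrs).exists_linearForm hd
    (fun k _ => ballRivoal_neg_sub hs hrs.le hn k) (tendsto_mul_ballRivoal hr)
  exact ⟨P, h1, by rw [← h2.tsum_eq, tsum_mul_left, ballRivoalSum]⟩

theorem lcmUpto_mono {m n : ℕ} (h : m ≤ n) : Nat.lcmUpto m ≤ Nat.lcmUpto n :=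
  Nat.le_of_dvd (Nat.lcmUpto_pos n) (lcm_mono (Icc_subset_Icc_right h))

theorem eventually_mul_pow_mul_exp_le_one (C : ℝ) (N : ℕ) {η : ℝ} (hη : 0 < η) :
    ∀ᶠ m : ℕ in atTop, C * (m : ℝ) ^ N * exp (-η * m) ≤ 1 := by
  have h : Tendsto (fun m : ℕ => C * ((m : ℝ) ^ N * exp (-η) ^ m)) atTop (𝓝 (C * 0)) :=
    (tendsto_pow_const_mul_const_pow_of_abs_lt_one N
      (by rw [abs_of_pos (exp_pos _), exp_lt_one_iff]; linarith)).const_mul C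
  filter_upwards [h.eventually_le_const (show C * 0 < 1 by simp)] with m hm
  rwa [← exp_nat_mul, mul_comm (m : ℝ), ← mul_assoc] at hm

theorem eventually_lcmUpto_pow_le {s : ℕ} (hs : 0 < s) :
    ∀ᶠ n : ℕ in atTop, (Nat.lcmUpto n : ℝ) ^ s ≤ exp ((s + 1 / 2) * n) := by
  have hs' : (0 : ℝ) < s := by exact_mod_cast hs
  filter_upwards [Chebyshev.eventually_lcmUpto_le (δ := 1 / (2 * s)) (by positivity)] with n hn
  calc _ ≤ exp ((1 + 1 / (2 * s)) * n) ^ s := by gcongr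
    _ = _ := by
      rw [← exp_nat_mul]
      congr 1
      field_simp

theorem decay_le_growth_mul_finrank {s r : ℕ} (hs : Odd s) (hr : 0 < r) (hrs : 2 * r < s)
    (V : Submodule ℚ ℝ) [FiniteDimensional ℚ V] (h1V : (1 : ℝ) ∈ V)
    (hV : ∀ i, Odd i → 3 ≤ i → i ≤ s → zetaVal i ∈ V) :
    (s - 2 * r) * log r - r * log 3 - s - 1 ≤
      (s + 1 + s * log 2 + 2 * r * log (3 * (r + 1))) * (Module.finrank ℚ V - 1) := by
  have hs0 : 0 < s := by omega
  have hs' : (0 : ℝ) < s := by exact_mod_cast hs0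
  have hr' : (0 : ℝ) < r := by exact_mod_cast hr
  choose P hP hPsum using fun m : ℕ =>
    exists_linearForm_ballRivoal hs hr hrs (even_two_mul m)
  let ξ : Option ((Icc 3 s).filter Odd) → ℝ := fun o => o.elim 1 fun l => zetaVal l
  let L : ℕ → Option ((Icc 3 s).filter Odd) → ℤ := fun m o => o.elim (P m 0) fun l => P m l
  have hsum : ∀ m, ∑ i, L m i * ξ i =
      2 * (Nat.lcmUpto (2 * m) : ℝ) ^ s * ballRivoalSum s r (2 * m) := by
    intro m
    rw [← hPsum, Fintype.sum_option]
    simp only [L, ξ, Option.elim, mul_one]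
    rw [← sum_coe_sort ((Icc 3 s).filter Odd)]
  have htwo : Tendsto (fun m : ℕ => 2 * m) atTop atTop :=
    tendsto_id.const_mul_atTop' (by norm_num)
  have hlcm := htwo.eventually (eventually_lcmUpto_pow_le hs0)
  set Z : ℝ := ∑' k : ℕ, 1 / ((k : ℝ) + 1) ^ 2
  have hZ : 0 ≤ Z := tsum_nonneg fun _ => by positivity
  have hlog3 : 0 ≤ log (3 * (r + 1)) := log_nonneg (by linarith)
  have hlog2 : 0 ≤ log 2 := (log_pos one_lt_two).le
  have main := decay_le_of_forms V ξ ?_ L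
    (a := 2 * ((s - 2 * r) * log r - r * log 3 - s - 1))
    (b := 2 * (s + 1 + s * log 2 + 2 * r * log (3 * (r + 1))))
    (C := 4 * (s : ℝ) ^ s + 2 * Z) (by positivity) ?_ ?_ ?_ ?_
  · linarith
  · rintro (_ | ⟨l, hl⟩)
    · exact h1V
    · simp only [mem_filter, mem_Icc] at hl
      exact hV l hl.2 hl.1.1 hl.1.2
  · filter_upwards [hlcm] with m hm i
    have hexp : ((2 * m : ℕ) : ℝ) + 1 ≤ 2 * exp (1 / 2 * (2 * m : ℕ)) := by
      have := add_one_le_exp (1 / 2 * ((2 * m : ℕ) : ℝ))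
      linarith
    have hM : ((s * 2 ^ (2 * m)) ^ (s - 2 * r) *
        (s * (2 ^ (2 * m) * (3 * (r + 1)) ^ (2 * m))) ^ (2 * r) : ℝ) =
        s ^ s * exp ((s * log 2 + 2 * r * log (3 * (r + 1))) * (2 * m : ℕ)) := by
      have e2 : exp (log 2) = 2 := exp_log two_pos
      have e3 : exp (log (3 * (r + 1))) = 3 * (r + 1) := exp_log (by positivity)
      have : exp ((s * log 2 + 2 * r * log (3 * (r + 1))) * (2 * m : ℕ)) =
          (2 ^ (2 * m)) ^ s * ((3 * (r + 1)) ^ (2 * m)) ^ (2 * r) := by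
        conv_rhs => rw [← e3]
        nth_rewrite 3 [← e2]
        rw [← exp_nat_mul, ← exp_nat_mul, ← exp_nat_mul, ← exp_nat_mul, ← exp_add]
        congr 1
        push_cast
        ring
      rw [this]
      have hsplit : s = (s - 2 * r) + 2 * r := by omega
      have e4 : (s : ℝ) ^ s = s ^ (s - 2 * r) * s ^ (2 * r) := by rw [← pow_add, ← hsplit]
      have e5 : ((2 : ℝ) ^ (2 * m)) ^ s =
          (2 ^ (2 * m)) ^ (s - 2 * r) * (2 ^ (2 * m)) ^ (2 * r) := by rw [← pow_add, ← hsplit]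
      rw [e4, e5]
      simp only [mul_pow]
      ring
    have hbound : 2 * (Nat.lcmUpto (2 * m) : ℝ) ^ s * ((s * 2 ^ (2 * m)) ^ (s - 2 * r) *
        (s * (2 ^ (2 * m) * (3 * (r + 1)) ^ (2 * m))) ^ (2 * r)) * ((2 * m : ℕ) + 1) ≤
        (4 * (s : ℝ) ^ s + 2 * Z) *
          exp (2 * (s + 1 + s * log 2 + 2 * r * log (3 * (r + 1))) * m) := by
      rw [hM]
      calc _ ≤ 2 * exp ((s + 1 / 2) * (2 * m : ℕ)) *
            (s ^ s * exp ((s * log 2 + 2 * r * log (3 * (r + 1))) * (2 * m : ℕ))) *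
            (2 * exp (1 / 2 * (2 * m : ℕ))) := by gcongr
        _ = 4 * (s : ℝ) ^ s * (exp ((s + 1 / 2) * (2 * m : ℕ)) *
            exp ((s * log 2 + 2 * r * log (3 * (r + 1))) * (2 * m : ℕ)) *
            exp (1 / 2 * (2 * m : ℕ))) := by ring
        _ = 4 * (s : ℝ) ^ s * exp (2 * (s + 1 + s * log 2 + 2 * r * log (3 * (r + 1))) * m) := by
          rw [← exp_add, ← exp_add]
          congr 2
          push_cast
          ring
        _ ≤ _ := by
          gcongr
          linarith
    rcases i with _ | ⟨l, hl⟩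
    · exact (hP m 0 (Nat.zero_le _)).trans hbound
    · simp only [mem_filter, mem_Icc] at hl
      exact (hP m l hl.1.2).trans hbound
  · intro m
    rw [hsum]
    have := ballRivoalSum_pos (a := s) (n := 2 * m) hr
    have := Nat.lcmUpto_pos (2 * m)
    positivity
  · filter_upwards [hlcm] with m hm
    have hbase : (3 ^ r / (r : ℝ) ^ (s - 2 * r)) ^ (2 * m) =
        exp ((r * log 3 - (s - 2 * r) * log r) * (2 * m : ℕ)) := by
      have e3 : exp (log 3) = 3 := exp_log three_pos
      have er : exp (log r) = r := exp_log hr'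
      have hsub : ((s - 2 * r : ℕ) : ℝ) = s - 2 * r := by
        rw [Nat.cast_sub hrs.le]
        push_cast
        ring
      rw [← hsub, mul_comm _ ((2 * m : ℕ) : ℝ), exp_nat_mul, exp_sub, exp_nat_mul, exp_nat_mul,
        e3, er]
    rw [hsum]
    calc _ ≤ 2 * exp ((s + 1 / 2) * (2 * m : ℕ)) *
          (exp ((r * log 3 - (s - 2 * r) * log r) * (2 * m : ℕ)) * Z) := by
          rw [← hbase]
          have := (ballRivoalSum_pos (a := s) (n := 2 * m) hr).le
          gcongr
          exact ballRivoalSum_le hr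
      _ = 2 * Z * exp (((s + 1 / 2) + (r * log 3 - (s - 2 * r) * log r)) * (2 * m : ℕ)) := by
          rw [add_mul (s + 1 / 2 : ℝ), exp_add]
          ring
      _ ≤ _ := by
          refine mul_le_mul (le_add_of_nonneg_left (by positivity)) (exp_le_exp.2 ?_)
            (exp_pos _).le (by positivity)
          have : (0 : ℝ) ≤ m := by positivity
          push_cast
          linarith
  · intro η hη
    obtain ⟨C, N, hC, hCN⟩ := exists_ballRivoalSum_le_succ hr hrs
    filter_upwards [eventually_mul_pow_mul_exp_le_one (C ^ 2 * (2 ^ N * 3 ^ N)) (N + N) hη,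
      eventually_gt_atTop 0] with m hm hm0
    rw [hsum, hsum]
    have hm1 : (1 : ℝ) ≤ m := by exact_mod_cast hm0
    have hS := (ballRivoalSum_pos (a := s) (n := 2 * (m + 1)) hr).le
    have hstep : ballRivoalSum s r (2 * m) * exp (-η * m) ≤ ballRivoalSum s r (2 * (m + 1)) := by
      have h1 := hCN (2 * m) (by omega)
      have h2 := hCN (2 * m + 1) (by omega)
      rw [show 2 * m + 1 + 1 = 2 * (m + 1) by ring] at h2
      calc _ ≤ C * (2 * m : ℕ) ^ N * (C * (2 * m + 1 : ℕ) ^ N * ballRivoalSum s r (2 * (m + 1))) *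
            exp (-η * m) := by
            gcongr
            exact h1.trans (by gcongr)
        _ ≤ C * (2 * m) ^ N * (C * (3 * m) ^ N * ballRivoalSum s r (2 * (m + 1))) *
            exp (-η * m) := by
            push_cast
            gcongr
            linarith
        _ = C ^ 2 * (2 ^ N * 3 ^ N) * (m : ℝ) ^ (N + N) * exp (-η * m) *
            ballRivoalSum s r (2 * (m + 1)) := by
            rw [mul_pow, mul_pow, pow_add]
            ring
        _ ≤ _ := mul_le_of_le_one_left hS hm
    have hmono : (Nat.lcmUpto (2 * m) : ℝ) ≤ Nat.lcmUpto (2 * (m + 1)) := by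
      exact_mod_cast lcmUpto_mono (by omega)
    have hS' := (ballRivoalSum_pos (a := s) (n := 2 * m) hr).le
    calc _ = 2 * (Nat.lcmUpto (2 * m) : ℝ) ^ s *
          (ballRivoalSum s r (2 * m) * exp (-η * m)) := by ring
      _ ≤ _ := by gcongr

end LinearForms

theorem stmt0 (ε : ℝ) (hε : 0 < ε) :
    ∃ S : ℕ, ∀ s : ℕ, Odd s → S ≤ s →
      ((1 - ε) / (1 + Real.log 2)) * Real.log s ≤
        (Module.finrank ℚ (Submodule.span ℚ
          ({1} ∪ {x : ℝ | ∃ i : ℕ, Odd i ∧ 3 ≤ i ∧ i ≤ s ∧ x = zetaVal i})) : ℝ) := by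
  have hlog2 : 0 < Real.log 2 := Real.log_pos one_lt_two
  rcases le_or_gt ε 1 with hε1 | hε1
  · obtain ⟨S, hS⟩ := Filter.eventually_atTop.1 (eventually_exists_parameter hε hε1)
    refine ⟨S, fun s hs hSs => ?_⟩
    obtain ⟨r, hr, hrs, hle⟩ := hS s hSs
    set V := Submodule.span ℚ
      ({1} ∪ {x : ℝ | ∃ i : ℕ, Odd i ∧ 3 ≤ i ∧ i ≤ s ∧ x = zetaVal i}) with hV
    have hfin : ({1} ∪ {x : ℝ | ∃ i : ℕ, Odd i ∧ 3 ≤ i ∧ i ≤ s ∧ x = zetaVal i}).Finite := by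
      refine (Set.finite_singleton _).union (((Set.finite_Iic s).image zetaVal).subset ?_)
      rintro x ⟨i, _, _, hi, rfl⟩
      exact ⟨i, hi, rfl⟩
    have : FiniteDimensional ℚ V := FiniteDimensional.span_of_finite ℚ hfin
    have hforms := decay_le_growth_mul_finrank hs hr hrs V (Submodule.subset_span (.inl rfl))
      fun i hi h3 his => Submodule.subset_span (.inr ⟨i, hi, h3, his, rfl⟩)
    have hlog : 0 ≤ Real.log (3 * (r + 1)) := Real.log_nonneg (by
      have : (0 : ℝ) ≤ r := by positivity
      linarith)
    have hB : 0 < (s + 1 + s * Real.log 2 + 2 * r * Real.log (3 * (r + 1)) : ℝ) := by positivity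
    have := le_of_mul_le_mul_left (((mul_comm _ _).trans_le hle).trans hforms) hB
    linarith
  · refine ⟨0, fun s _ _ => le_trans ?_ (Nat.cast_nonneg _)⟩
    exact mul_nonpos_of_nonpos_of_nonneg
      (div_nonpos_of_nonpos_of_nonneg (by linarith) (by linarith)) (Real.log_natCast_nonneg s)
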